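/- Let p, q be positive integers such that either (p > 1 and q > 1) or (p = 1 and q is even). Let J = diag(I_p, -I_q), let G = {A ∈ GL(p+q, ℂ) : Aᵀ J A = J and det A = 1} (a copy of the complex special orthogonal group SO(p+q, ℂ)), and let H = {A ∈ G : every entry of A is real} (the real form SO(p,q) of G). Then there is no discrete subgroup Γ of G acting properly discontinuously and cocompactly on the homogeneous space G/H; that is, SO(p+q,ℂ)/SO(p,q) admits no compact Clifford–Klein form. -/

import Mathlib

/-!
The homogeneous space `SO(p+q,ℂ)/SO(p,q)` admits no compact Clifford–Klein form
when `p > 1` and `q > 1`, or `p = 1` and `q` is even.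
-/

open Matrix

set_option maxHeartbeats 1000000
set_option synthInstance.maxHeartbeats 1000000

noncomputable section

/-- The matrix `J = diag(I_p, -I_q)` over `ℂ`. -/
def JC (p q : ℕ) : Matrix (Fin p ⊕ Fin q) (Fin p ⊕ Fin q) ℂ :=
  Matrix.diagonal (Sum.elim (fun _ => 1) (fun _ => -1))

/-- A copy of the complex special orthogonal group `SO(p+q, ℂ)`: the subgroup of
`GL(p+q, ℂ)` of matrices `A` with `Aᵀ J A = J` and `det A = 1`, where `J = diag(I_p, -I_q)`. -/
def SOC (p q : ℕ) : Subgroup (GL (Fin p ⊕ Fin q) ℂ) where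
  carrier := {A | A.valᵀ * JC p q * A.val = JC p q ∧ A.val.det = 1}
  one_mem' := by constructor <;> simp
  mul_mem' := by
    rintro A B ⟨hA1, hA2⟩ ⟨hB1, hB2⟩
    constructor
    · have key : (A * B).valᵀ * JC p q * (A * B).val =
          B.valᵀ * (A.valᵀ * JC p q * A.val) * B.val := by
        rw [Units.val_mul, transpose_mul]
        simp only [Matrix.mul_assoc]
      rw [key, hA1]
      exact hB1
    · rw [Units.val_mul, det_mul, hA2, hB2, mul_one]
  inv_mem' := by
    rintro A ⟨hA1, hA2⟩
    constructor
    · calc (A⁻¹).valᵀ * JC p q * (A⁻¹).val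
          = (A⁻¹).valᵀ * (A.valᵀ * JC p q * A.val) * (A⁻¹).val := by rw [hA1]
        _ = (A.val * (A⁻¹).val)ᵀ * JC p q * (A.val * (A⁻¹).val) := by
            rw [transpose_mul]
            simp only [Matrix.mul_assoc]
        _ = JC p q := by rw [Units.mul_inv]; simp
    · have h := congrArg Matrix.det (Units.mul_inv A)
      rw [det_mul, hA2, one_mul] at h
      simpa using h

/-- A matrix has real entries if the imaginary part of every entry vanishes. -/
def RealEntries {ι : Type*} (M : Matrix ι ι ℂ) : Prop := ∀ i j, (M i j).im = 0

theorem RealEntries.mul {ι : Type*} [Fintype ι] {M N : Matrix ι ι ℂ}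
    (hM : RealEntries M) (hN : RealEntries N) : RealEntries (M * N) := by
  intro i j
  rw [Matrix.mul_apply, Complex.im_sum]
  refine Finset.sum_eq_zero fun k _ => ?_
  rw [Complex.mul_im, hM i k, hN k j]
  ring

theorem realEntries_JC (p q : ℕ) : RealEntries (JC p q) := by
  intro i j
  rcases eq_or_ne i j with h | h
  · subst h
    rw [JC, Matrix.diagonal_apply_eq]
    rcases i with i | i <;> simp
  · rw [JC, Matrix.diagonal_apply_ne _ h]
    simp

theorem RealEntries.transpose {ι : Type*} {M : Matrix ι ι ℂ} (hM : RealEntries M) :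
    RealEntries Mᵀ := fun i j => hM j i

/-- The real form `SO(p,q)` of `SO(p+q,ℂ)`: the subgroup of elements all of whose
entries are real. -/
def SOCrealForm (p q : ℕ) : Subgroup ↥(SOC p q) where
  carrier := {A | RealEntries A.val.val}
  one_mem' := by
    intro i j
    show ((1 : Matrix (Fin p ⊕ Fin q) (Fin p ⊕ Fin q) ℂ) i j).im = 0
    rcases eq_or_ne i j with h | h
    · subst h; simp
    · rw [Matrix.one_apply_ne h]; simp
  mul_mem' := by
    intro A B hA hB
    have h : (A * B).val.val = A.val.val * B.val.val := rfl
    show RealEntries (A * B).val.val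
    rw [h]
    exact hA.mul hB
  inv_mem' := by
    intro A hA
    show RealEntries (A⁻¹).val.val
    obtain ⟨hA1, -⟩ := A.prop
    have hJJ : JC p q * JC p q = 1 := by
      rw [JC, Matrix.diagonal_mul_diagonal]
      ext i j
      rcases eq_or_ne i j with h | h
      · subst h
        rw [Matrix.diagonal_apply_eq]
        rcases i with i | i <;> simp [Matrix.one_apply]
      · rw [Matrix.diagonal_apply_ne _ h, Matrix.one_apply_ne h]
    have hleft : (JC p q * A.val.valᵀ * JC p q) * A.val.val = 1 := by
      calc (JC p q * A.val.valᵀ * JC p q) * A.val.val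
          = JC p q * (A.val.valᵀ * JC p q * A.val.val) := by simp only [Matrix.mul_assoc]
        _ = JC p q * JC p q := by rw [hA1]
        _ = 1 := hJJ
    have hAinv : A.val.val * (A⁻¹).val.val = 1 := by
      have h : (A⁻¹).val = (A.val)⁻¹ := rfl
      rw [h]; exact Units.mul_inv A.val
    have heq : (A⁻¹).val.val = JC p q * A.val.valᵀ * JC p q := by
      have h2 : (JC p q * A.val.valᵀ * JC p q) * (A.val.val * (A⁻¹).val.val) =
          (A⁻¹).val.val := by
        rw [← Matrix.mul_assoc, hleft, Matrix.one_mul]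
      rw [hAinv, Matrix.mul_one] at h2
      exact h2.symm
    rw [heq]
    exact ((realEntries_JC p q).mul hA.transpose).mul (realEntries_JC p q)

theorem Polynomial.sq_ne_C_mul_one_add_X_sq_pow {c : ℝ} (hc : c ≠ 0) {n : ℕ} (hn : Odd n)
    (P : Polynomial ℝ) : P ^ 2 ≠ Polynomial.C c * (1 + Polynomial.X ^ 2) ^ n := by
  intro h
  have h2 := congrArg (Polynomial.map (algebraMap ℝ ℂ)) h
  set R := P.map (algebraMap ℝ ℂ)
  have h3 : R ^ 2 = Polynomial.C (c : ℂ) * ((Polynomial.X - Polynomial.C Complex.I) ^ n *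
      (Polynomial.X - Polynomial.C (-Complex.I)) ^ n) := by
    rw [← mul_pow]
    have : (Polynomial.X - Polynomial.C Complex.I) * (Polynomial.X - Polynomial.C (-Complex.I))
        = 1 + Polynomial.X ^ 2 := by
      have hI : (Polynomial.C Complex.I) * (Polynomial.C Complex.I) = -1 := by
        rw [← Polynomial.C_mul, Complex.I_mul_I]; simp
      rw [Polynomial.C_neg]
      linear_combination -hI
    rw [this]
    simpa [R] using h2
  have hR : R ≠ 0 := by
    intro h0
    rw [h0] at h3
    have h4 := congrArg (Polynomial.eval 0) h3
    simp [hc] at h4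
  have hpos : (Polynomial.X - Polynomial.C (-Complex.I)) ^ n ≠ 0 :=
    pow_ne_zero _ (Polynomial.X_sub_C_ne_zero _)
  have hpos' : (Polynomial.X - Polynomial.C (Complex.I)) ^ n ≠ 0 :=
    pow_ne_zero _ (Polynomial.X_sub_C_ne_zero _)
  have hcC : Polynomial.C (c : ℂ) ≠ 0 := by simpa using hc
  have h4 := congrArg (Polynomial.rootMultiplicity Complex.I) h3
  rw [sq, Polynomial.rootMultiplicity_mul (mul_ne_zero hR hR),
    Polynomial.rootMultiplicity_mul (mul_ne_zero hcC (mul_ne_zero hpos' hpos)),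
    Polynomial.rootMultiplicity_mul (mul_ne_zero hpos' hpos),
    Polynomial.rootMultiplicity_C, Polynomial.rootMultiplicity_X_sub_C_pow,
    Polynomial.rootMultiplicity_eq_zero (p := (Polynomial.X - Polynomial.C (-Complex.I)) ^ n)] at h4
  · obtain ⟨k, rfl⟩ := hn
    omega
  · simp [Polynomial.IsRoot, ← two_mul]

section

variable {E : Type*} [NormedAddCommGroup E] [InnerProductSpace ℝ E] [FiniteDimensional ℝ E]

theorem ContinuousLinearMap.det_id_add_smul_pos {A : E →L[ℝ] E} {L t : ℝ} (hA : ‖A‖ ≤ L)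
    (ht : 0 ≤ t) (htL : t * L < 1) : 0 < (ContinuousLinearMap.id ℝ E + t • A).det := by
  by_contra! hneg
  have hcont : Continuous fun s : ℝ => (ContinuousLinearMap.id ℝ E + s • A).det :=
    ContinuousLinearMap.continuous_det.comp (by fun_prop)
  have h0 : (ContinuousLinearMap.id ℝ E + (0 : ℝ) • A).det = 1 := by
    simp [ContinuousLinearMap.det]
  obtain ⟨s, hs, hs0⟩ := intermediate_value_Icc' ht hcont.continuousOn
    (show (0 : ℝ) ∈ Set.Icc _ _ from ⟨hneg, by rw [h0]; exact zero_le_one⟩)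
  obtain ⟨v, hv, hv0⟩ := Submodule.exists_mem_ne_zero_of_ne_bot
    (LinearMap.bot_lt_ker_of_det_eq_zero hs0).ne'
  have h1 : v = -(s • A v) := by
    have : v + s • A v = 0 := by simpa using hv
    exact eq_neg_of_add_eq_zero_left this
  have h2 : ‖v‖ ≤ s * (L * ‖v‖) := by
    calc ‖v‖ = ‖s • A v‖ := (congrArg norm h1).trans (norm_neg _)
      _ = s * ‖A v‖ := by rw [norm_smul, Real.norm_of_nonneg hs.1]
      _ ≤ s * (L * ‖v‖) := by
        gcongr
        · exact hs.1
        · exact A.le_of_opNorm_le hA v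
  have h3 : s * L ≤ t * L := by
    gcongr
    · exact (norm_nonneg _).trans hA
    · exact hs.2
  have h4 : 0 < ‖v‖ := norm_pos_iff.2 hv0
  nlinarith

theorem ContinuousLinearMap.exists_polynomial_eval_eq_det_id_add_smul (A : E →L[ℝ] E) :
    ∃ Q : Polynomial ℝ, Q.natDegree ≤ Module.finrank ℝ E ∧
      ∀ t : ℝ, Q.eval t = (ContinuousLinearMap.id ℝ E + t • A).det := by
  classical
  let b := Module.finBasis ℝ E
  let M : Matrix (Fin (Module.finrank ℝ E)) (Fin (Module.finrank ℝ E)) ℝ :=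
    LinearMap.toMatrix b b (A : E →ₗ[ℝ] E)
  refine ⟨((Polynomial.X : Polynomial ℝ) • M.map Polynomial.C +
    (1 : Matrix (Fin (Module.finrank ℝ E)) (Fin (Module.finrank ℝ E)) ℝ).map
      Polynomial.C).det, ?_, ?_⟩
  · simpa using Polynomial.natDegree_det_X_add_C_le M 1
  · intro t
    rw [← Polynomial.coe_evalRingHom, RingHom.map_det, ContinuousLinearMap.det,
      ← LinearMap.det_toMatrix b]
    congr 1
    have : ((ContinuousLinearMap.id ℝ E + t • A : E →L[ℝ] E) : E →ₗ[ℝ] E)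
      = LinearMap.id + t • (A : E →ₗ[ℝ] E) := rfl
    have h2 : LinearMap.toMatrix b b (LinearMap.id + t • (A : E →ₗ[ℝ] E)) = 1 + t • M := by
      simp only [map_add, map_smul, LinearMap.toMatrix_id, M]
    rw [this, h2]
    ext i j
    simp [M, Matrix.one_apply, add_comm]
    split_ifs <;> simp [mul_comm]

end

section

open MeasureTheory

variable {E : Type*} [NormedAddCommGroup E] [InnerProductSpace ℝ E]

theorem norm_add_smul_of_inner_eq_zero {x y : E} (h : inner ℝ y x = 0) (hn : ‖y‖ = ‖x‖) (t : ℝ) :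
    ‖x + t • y‖ = √(1 + t ^ 2) * ‖x‖ := by
  rw [← sq_eq_sq₀ (norm_nonneg _) (by positivity), norm_add_sq_real, inner_smul_right,
    real_inner_comm, h, norm_smul, hn, mul_pow, mul_pow, Real.sq_sqrt (by positivity)]
  simp
  ring

theorem LipschitzWith.injective_id_add_smul {F : E → E} {L : NNReal} (hL : LipschitzWith L F)
    {t : ℝ} (ht : 0 ≤ t) (htL : t * L < 1) : Function.Injective fun x => x + t • F x := by
  intro x y hxy
  have h1 : x - y = t • (F y - F x) := by
    rw [smul_sub, sub_eq_sub_iff_add_eq_add, add_comm (t • F y)]; exact hxy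
  have h2 : ‖x - y‖ ≤ t * (L * ‖x - y‖) := by
    calc ‖x - y‖ = t * ‖F y - F x‖ := by rw [h1, norm_smul, Real.norm_of_nonneg ht]
      _ ≤ t * (L * ‖y - x‖) := by gcongr; exact hL.norm_sub_le y x
      _ = _ := by rw [norm_sub_rev]
  by_contra hne
  have h3 : 0 < ‖x - y‖ := norm_pos_iff.2 (sub_ne_zero.2 hne)
  nlinarith

variable [FiniteDimensional ℝ E]

theorem LipschitzWith.surjective_id_add_smul {F : E → E} {L : NNReal} (hL : LipschitzWith L F)
    {t : ℝ} (ht : 0 ≤ t) (htL : t * L < 1) : Function.Surjective fun x => x + t • F x := by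
  have happ : ApproximatesLinearOn (fun x => x + t • F x)
      ((ContinuousLinearEquiv.refl ℝ E : E ≃L[ℝ] E) : E →L[ℝ] E) Set.univ (t.toNNReal * L) := by
    intro x _ y _
    have : x + t • F x - (y + t • F y) -
        ((ContinuousLinearEquiv.refl ℝ E : E ≃L[ℝ] E) : E →L[ℝ] E) (x - y) = t • (F x - F y) := by
      simp only [ContinuousLinearEquiv.coe_refl, ContinuousLinearMap.id_apply]
      module
    rw [this, norm_smul, Real.norm_of_nonneg ht]
    push_cast
    rw [Real.coe_toNNReal _ ht, mul_assoc]
    gcongr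
    exact hL.norm_sub_le x y
  refine happ.surjective ?_
  rcases subsingleton_or_nontrivial E with h | h
  · exact Or.inl h
  · right
    have : ‖((ContinuousLinearEquiv.refl ℝ E).symm : E →L[ℝ] E)‖₊ = 1 := by

      exact ContinuousLinearMap.nnnorm_id
    rw [this, inv_one, ← NNReal.coe_lt_coe]
    push_cast
    rwa [Real.coe_toNNReal _ ht]

theorem LipschitzWith.image_ball_id_add_smul {F : E → E} {L : NNReal} (hL : LipschitzWith L F)
    (hn : ∀ x, ‖F x‖ = ‖x‖) (ho : ∀ x, inner ℝ (F x) x = 0)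
    {t : ℝ} (ht : 0 ≤ t) (htL : t * L < 1) :
    (fun x => x + t • F x) '' (Metric.ball 0 1 \ {0}) = Metric.ball 0 (√(1 + t ^ 2)) \ {0} := by
  have hpos : 0 < √(1 + t ^ 2) := by positivity
  have key : ∀ x, x + t • F x ∈ Metric.ball (0 : E) (√(1 + t ^ 2)) \ {0} ↔
      x ∈ Metric.ball (0 : E) 1 \ {0} := by
    intro x
    have h := norm_add_smul_of_inner_eq_zero (ho x) (hn x) t
    simp only [Set.mem_sdiff, mem_ball_zero_iff, Set.mem_singleton_iff, ← norm_eq_zero (E := E), h,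
      mul_eq_zero, hpos.ne', false_or]
    rw [mul_lt_iff_lt_one_right hpos]
  ext y
  constructor
  · rintro ⟨x, hx, rfl⟩
    exact (key x).2 hx
  · intro hy
    obtain ⟨x, rfl⟩ := hL.surjective_id_add_smul ht htL y
    exact ⟨x, (key x).1 hy, rfl⟩

theorem LipschitzWith.integral_det_id_add_smul_fderiv [MeasurableSpace E] [BorelSpace E]
    [Nontrivial E] {F : E → E} {L : NNReal} (hL : LipschitzWith L F)
    (hd : ∀ x, x ≠ 0 → DifferentiableAt ℝ F x)
    (hn : ∀ x, ‖F x‖ = ‖x‖) (ho : ∀ x, inner ℝ (F x) x = 0)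
    {t : ℝ} (ht : 0 ≤ t) (htL : t * L < 1) :
    IntegrableOn (fun x => (ContinuousLinearMap.id ℝ E + t • fderiv ℝ F x).det)
      (Metric.ball 0 1 \ {0}) volume ∧
    ∫ x in Metric.ball 0 1 \ {0}, (ContinuousLinearMap.id ℝ E + t • fderiv ℝ F x).det =
      √(1 + t ^ 2) ^ Module.finrank ℝ E * volume.real (Metric.ball (0 : E) 1) := by
  have hmeas : MeasurableSet (Metric.ball (0 : E) 1 \ {0}) :=
    Metric.isOpen_ball.measurableSet.diff (measurableSet_singleton 0)
  have hder : ∀ x ∈ Metric.ball (0 : E) 1 \ {0}, HasFDerivWithinAt (fun x => x + t • F x)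
      (ContinuousLinearMap.id ℝ E + t • fderiv ℝ F x) (Metric.ball (0 : E) 1 \ {0}) x := by
    intro x hx
    exact ((hasFDerivAt_id x).add ((hd x hx.2).hasFDerivAt.const_smul t)).hasFDerivWithinAt
  have hinj := (hL.injective_id_add_smul ht htL).injOn (s := Metric.ball (0 : E) 1 \ {0})
  have himg := hL.image_ball_id_add_smul hn ho ht htL
  have hpos : ∀ x, |(ContinuousLinearMap.id ℝ E + t • fderiv ℝ F x).det| • (1 : ℝ) =
      (ContinuousLinearMap.id ℝ E + t • fderiv ℝ F x).det := by
    intro x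
    rw [smul_eq_mul, mul_one, abs_of_pos]
    exact ContinuousLinearMap.det_id_add_smul_pos (norm_fderiv_le_of_lipschitz ℝ hL) ht htL
  have h1 := integral_image_eq_integral_abs_det_fderiv_smul volume hmeas hder hinj
    (fun _ => (1 : ℝ))
  have h2 := integrableOn_image_iff_integrableOn_abs_det_fderiv_smul volume hmeas hder hinj
    (fun _ => (1 : ℝ))
  simp only [hpos] at h1 h2
  rw [himg] at h1 h2
  have hfin : volume (Metric.ball (0 : E) (√(1 + t ^ 2)) \ {0}) < ⊤ :=
    (measure_mono Set.sdiff_subset).trans_lt measure_ball_lt_top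
  refine ⟨h2.1 (integrableOn_const hfin.ne), ?_⟩
  rw [← h1, setIntegral_const, smul_eq_mul, mul_one, Measure.real,
    measure_sdiff_null (measure_singleton 0), Measure.addHaar_ball _ _ (by positivity),
    ENNReal.toReal_mul, ENNReal.toReal_ofReal (by positivity), Measure.real]

theorem LipschitzWith.not_odd_finrank_of_tangent [MeasurableSpace E] [BorelSpace E]
    {F : E → E} {L : NNReal} (hL : LipschitzWith L F)
    (hd : ∀ x, x ≠ 0 → DifferentiableAt ℝ F x)
    (hn : ∀ x, ‖F x‖ = ‖x‖) (ho : ∀ x, inner ℝ (F x) x = 0) :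
    ¬ Odd (Module.finrank ℝ E) := by
  intro hodd
  set n := Module.finrank ℝ E with hndef
  have hnt : Nontrivial E := Module.nontrivial_of_finrank_pos (R := ℝ) hodd.pos
  choose Q hQdeg hQ using fun x =>
    ContinuousLinearMap.exists_polynomial_eval_eq_det_id_add_smul (fderiv ℝ F x)
  set ε : ℝ := 1 / (L + 1) with hε
  have hLpos : (0 : ℝ) < L + 1 := by positivity
  have hεL : ∀ t, t < ε → t * L < 1 ∨ t < 0 := by
    intro t ht
    rw [hε, lt_div_iff₀ hLpos] at ht
    by_cases h : t < 0
    · exact Or.inr h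
    · left
      nlinarith
  have hεpos : 0 < ε := by positivity
  let v : ℕ → ℝ := fun j => ε * ((j + 1 : ℝ) / (n + 2))
  have hv0 : ∀ j, 0 ≤ v j := fun j => by positivity
  have hvε : ∀ j ∈ Finset.range (n + 1), v j < ε := by
    intro j hj
    have h1 : (j : ℝ) < n + 1 := by exact_mod_cast Finset.mem_range.1 hj
    have : (j + 1 : ℝ) / (n + 2) < 1 := by rw [div_lt_one (by positivity)]; linarith
    simpa [v] using mul_lt_mul_of_pos_left this hεpos
  have hvinj : Set.InjOn v (Finset.range (n + 1)) := by
    intro i _ j _ hij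
    have h1 := mul_left_cancel₀ hεpos.ne' hij
    rw [div_left_inj' (by positivity)] at h1
    exact_mod_cast add_right_cancel h1
  set c := volume.real (Metric.ball (0 : E) 1) with hc
  have hcpos : 0 < c := by
    rw [hc, Measure.real]
    exact ENNReal.toReal_pos (Metric.measure_ball_pos volume 0 one_pos).ne' measure_ball_lt_top.ne
  let P : Polynomial ℝ := Lagrange.interpolate (Finset.range (n + 1)) v
    (fun j => √(1 + v j ^ 2) ^ n * c)
  have hP : ∀ t, 0 ≤ t → t < ε → P.eval t = √(1 + t ^ 2) ^ n * c := by
    intro t ht htε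
    have h1 := (hL.integral_det_id_add_smul_fderiv hd hn ho ht
      ((hεL t htε).resolve_right (not_lt.2 ht))).2
    rw [← h1]
    have h2 : ∀ x, (ContinuousLinearMap.id ℝ E + t • fderiv ℝ F x).det =
        ∑ j ∈ Finset.range (n + 1), (ContinuousLinearMap.id ℝ E + v j • fderiv ℝ F x).det *
          (Lagrange.basis (Finset.range (n + 1)) v j).eval t := by
      intro x
      have hdeg : (Q x).degree < (Finset.range (n + 1)).card := by
        rw [Finset.card_range]
        refine lt_of_le_of_lt Polynomial.degree_le_natDegree ?_
        exact_mod_cast Nat.lt_succ_of_le (hQdeg x)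
      have h3 := Lagrange.eq_interpolate (f := Q x) hvinj hdeg
      rw [← hQ, h3, Lagrange.interpolate_apply, Polynomial.eval_finsetSum]
      simp only [Polynomial.eval_mul, Polynomial.eval_C, hQ]
    simp only [h2]
    rw [integral_finsetSum]
    · simp only [P, Lagrange.interpolate_apply, Polynomial.eval_finsetSum, Polynomial.eval_mul,
        Polynomial.eval_C]
      refine Finset.sum_congr rfl fun j hj => ?_
      rw [integral_mul_const, (hL.integral_det_id_add_smul_fderiv hd hn ho (hv0 j)
        ((hεL _ (hvε j hj)).resolve_right (not_lt.2 (hv0 j)))).2]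
    · intro j hj
      exact (hL.integral_det_id_add_smul_fderiv hd hn ho (hv0 j)
        ((hεL _ (hvε j hj)).resolve_right (not_lt.2 (hv0 j)))).1.mul_const _
  refine Polynomial.sq_ne_C_mul_one_add_X_sq_pow (c := c ^ 2) (by positivity) hodd P ?_
  refine Polynomial.eq_of_infinite_eval_eq _ _ ((Set.Ioo_infinite hεpos).mono fun t ht => ?_)
  simp only [Set.mem_ofPred_eq, Polynomial.eval_pow, hP t ht.1.le ht.2, Polynomial.eval_mul,
    Polynomial.eval_C, Polynomial.eval_add, Polynomial.eval_one, Polynomial.eval_X]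
  rw [mul_pow, ← pow_mul, mul_comm n 2, pow_mul, Real.sq_sqrt (by positivity), mul_comm]

end

section

variable {E : Type*} [NormedAddCommGroup E] [InnerProductSpace ℝ E]

theorem norm_inv_norm_smul_le (a : E) : ‖‖a‖⁻¹ • a‖ ≤ 1 := by
  rw [norm_smul, norm_inv, norm_norm]
  exact inv_mul_le_one

theorem norm_mul_norm_sub_inv_norm_smul_le (a b : E) :
    ‖a‖ * ‖‖a‖⁻¹ • a - ‖b‖⁻¹ • b‖ ≤ 2 * ‖a - b‖ := by
  have h : ∀ c : E, ‖c‖ • ‖c‖⁻¹ • c = c := by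
    intro c
    rcases eq_or_ne c 0 with rfl | hc
    · simp
    · rw [smul_smul, mul_inv_cancel₀ (norm_ne_zero_iff.2 hc), one_smul]
  have h1 : ‖a‖ • (‖a‖⁻¹ • a - ‖b‖⁻¹ • b) = (a - b) + (‖b‖ - ‖a‖) • ‖b‖⁻¹ • b := by
    rw [smul_sub, sub_smul, h, h]
    abel
  calc ‖a‖ * ‖‖a‖⁻¹ • a - ‖b‖⁻¹ • b‖ = ‖(a - b) + (‖b‖ - ‖a‖) • ‖b‖⁻¹ • b‖ := by
        rw [← h1, norm_smul, norm_norm]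
    _ ≤ ‖a - b‖ + |‖b‖ - ‖a‖| * 1 := by
        refine (norm_add_le _ _).trans ?_
        rw [norm_smul _ (‖b‖⁻¹ • b), Real.norm_eq_abs]
        gcongr
        exact norm_inv_norm_smul_le b
    _ ≤ ‖a - b‖ + ‖a - b‖ := by
        rw [mul_one, abs_sub_comm]
        gcongr
        exact abs_norm_sub_norm_le a b
    _ = 2 * ‖a - b‖ := by ring

theorem exists_contDiff_tangent_ne_zero [FiniteDimensional ℝ E] {w : E → E}
    (hw : ContinuousOn w (Metric.sphere 0 1))
    (ht : ∀ x ∈ Metric.sphere (0 : E) 1, inner ℝ (w x) x = 0)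
    (h0 : ∀ x ∈ Metric.sphere (0 : E) 1, w x ≠ 0) :
    ∃ T : E → E, ContDiff ℝ 1 T ∧ ∀ x ∈ Metric.sphere (0 : E) 1,
      T x ≠ 0 ∧ inner ℝ (T x) x = 0 := by
  obtain ⟨δ, hδ, hδw⟩ : ∃ δ : ℝ, 0 < δ ∧ ∀ x ∈ Metric.sphere (0 : E) 1, 2 * δ ≤ ‖w x‖ := by
    rcases (Metric.sphere (0 : E) 1).eq_empty_or_nonempty with he | hne
    · exact ⟨1, one_pos, by simp [he]⟩
    · obtain ⟨x₀, hx₀, hmin⟩ := (isCompact_sphere (0 : E) 1).exists_isMinOn hne hw.norm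
      refine ⟨‖w x₀‖ / 2, half_pos (norm_pos_iff.2 (h0 x₀ hx₀)), fun x hx => ?_⟩
      rw [mul_div_cancel₀ _ two_ne_zero]
      exact hmin hx
  obtain ⟨g, hg⟩ := ContinuousMap.exists_restrict_eq
    (Metric.isClosed_sphere (x := (0 : E)) (ε := 1))
    (⟨fun x => w x, continuousOn_iff_continuous_domRestrict.1 hw⟩ : C(Metric.sphere (0 : E) 1, E))
  have hgw : ∀ x ∈ Metric.sphere (0 : E) 1, g x = w x := fun x hx => DFunLike.congr_fun hg ⟨x, hx⟩
  obtain ⟨W, hW, hWg, -⟩ := g.continuous.exists_contDiff_approx 1 (ε := fun _ => δ)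
    continuous_const fun _ => hδ
  have hW1 : ContDiff ℝ 1 W := hW
  refine ⟨fun x => W x - inner ℝ (W x) x • x,
    hW1.sub ((hW1.inner ℝ contDiff_id).smul contDiff_id),
    fun x hx => ⟨fun hx0 => ?_, ?_⟩⟩
  · have hx1 : ‖x‖ = 1 := by simpa using hx
    have h1 : ‖W x - w x‖ < δ := by
      rw [← hgw x hx, ← dist_eq_norm]; exact hWg x
    have h2 : w x = -((W x - w x) - inner ℝ (W x - w x) x • x) := by
      rw [inner_sub_left, ht x hx, sub_zero]
      rw [sub_right_comm, show W x - inner ℝ (W x) x • x = 0 from hx0, zero_sub, neg_neg]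
    have h3 : ‖w x‖ ≤ ‖W x - w x‖ + ‖W x - w x‖ := by
      conv_lhs => rw [h2, norm_neg]
      refine (norm_sub_le _ _).trans ?_
      gcongr
      rw [norm_smul, hx1, mul_one]
      simpa [hx1] using norm_inner_le_norm (𝕜 := ℝ) (W x - w x) x
    linarith [hδw x hx]
  · have hx1 : ‖x‖ = 1 := by simpa using hx
    rw [inner_sub_left, inner_smul_left, real_inner_self_eq_norm_sq, hx1]
    simp

/-- **Hairy ball theorem**: a continuous tangent vector field on the unit sphere of an
odd-dimensional Euclidean space vanishes somewhere. -/
theorem exists_eq_zero_of_tangent_sphere [FiniteDimensional ℝ E] (hodd : Odd (Module.finrank ℝ E))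
    {w : E → E} (hw : ContinuousOn w (Metric.sphere 0 1))
    (ht : ∀ x ∈ Metric.sphere (0 : E) 1, inner ℝ (w x) x = 0) :
    ∃ x ∈ Metric.sphere (0 : E) 1, w x = 0 := by
  by_contra! h0
  obtain ⟨T, hT, hT0⟩ := exists_contDiff_tangent_ne_zero hw ht h0
  have hnt : Nontrivial E := Module.nontrivial_of_finrank_pos (R := ℝ) hodd.pos
  obtain ⟨m, hm, hmT⟩ : ∃ m : ℝ, 0 < m ∧ ∀ x ∈ Metric.sphere (0 : E) 1, m ≤ ‖T x‖ := by
    obtain ⟨x₀, hx₀, hmin⟩ := (isCompact_sphere (0 : E) 1).exists_isMinOn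
      (NormedSpace.sphere_nonempty.2 zero_le_one) hT.continuous.norm.continuousOn
    exact ⟨‖T x₀‖, norm_pos_iff.2 (hT0 x₀ hx₀).1, fun x hx => hmin hx⟩
  obtain ⟨K, hK⟩ : ∃ K : NNReal, LipschitzOnWith K T (Metric.closedBall 0 1) := by
    obtain ⟨C, hC⟩ := (isCompact_closedBall (0 : E) 1).exists_bound_of_continuousOn
      (hT.continuous_fderiv one_ne_zero).continuousOn
    refine ⟨C.toNNReal, (convex_closedBall (0 : E) 1).lipschitzOnWith_of_nnnorm_fderiv_le
      (fun x _ => (hT.differentiable one_ne_zero) x) fun x hx => ?_⟩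
    rw [← NNReal.coe_le_coe, coe_nnnorm]
    exact (hC x hx).trans (Real.le_coe_toNNReal C)
  have hunit : ∀ x : E, x ≠ 0 → ‖x‖⁻¹ • x ∈ Metric.sphere (0 : E) 1 := by
    intro x hx
    rw [mem_sphere_zero_iff_norm, norm_smul, norm_inv, norm_norm,
      inv_mul_cancel₀ (norm_ne_zero_iff.2 hx)]
  let N : E → E := fun x => ‖T x‖⁻¹ • T x
  let F : E → E := fun x => ‖x‖ • N (‖x‖⁻¹ • x)
  have hN1 : ∀ x ∈ Metric.sphere (0 : E) 1, ‖N x‖ = 1 := by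
    intro x hx
    simp only [N]
    rw [norm_smul, norm_inv, norm_norm, inv_mul_cancel₀ (norm_ne_zero_iff.2 (hT0 x hx).1)]
  have hNL : ∀ x ∈ Metric.sphere (0 : E) 1, ∀ y ∈ Metric.sphere (0 : E) 1,
      ‖N x - N y‖ ≤ 2 * K / m * ‖x - y‖ := by
    intro x hx y hy
    have h1 := norm_mul_norm_sub_inv_norm_smul_le (T x) (T y)
    have h2 := hK.norm_sub_le (Metric.sphere_subset_closedBall hx)
      (Metric.sphere_subset_closedBall hy)
    have h3 : m * ‖N x - N y‖ ≤ ‖T x‖ * ‖N x - N y‖ := by gcongr; exact hmT x hx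
    rw [div_mul_eq_mul_div, le_div_iff₀ hm]
    calc ‖N x - N y‖ * m = m * ‖N x - N y‖ := mul_comm _ _
      _ ≤ 2 * ‖T x - T y‖ := h3.trans h1
      _ ≤ 2 * (K * ‖x - y‖) := by gcongr
      _ = _ := by ring
  have hFn : ∀ x, ‖F x‖ = ‖x‖ := by
    intro x
    rcases eq_or_ne x 0 with rfl | hx
    · simp [F]
    · simp only [F]
      rw [norm_smul, norm_norm, hN1 _ (hunit x hx), mul_one]
  have hF0 : F 0 = 0 := by simp [F]
  have hFL : LipschitzWith (4 * K / ⟨m, hm.le⟩ + 1) F := by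
    refine LipschitzWith.of_dist_le_mul fun x y => ?_
    push_cast
    rw [dist_eq_norm, dist_eq_norm]
    have hA : (0 : ℝ) ≤ 4 * K / m := by positivity
    rcases eq_or_ne x 0 with rfl | hx
    · rw [hF0, zero_sub, norm_neg, hFn, zero_sub, norm_neg]
      exact le_mul_of_one_le_left (norm_nonneg _) (by simp)
    rcases eq_or_ne y 0 with rfl | hy
    · rw [hF0, sub_zero, hFn, sub_zero]
      exact le_mul_of_one_le_left (norm_nonneg _) (by simp)
    have h1 : F x - F y = ‖x‖ • (N (‖x‖⁻¹ • x) - N (‖y‖⁻¹ • y)) +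
        (‖x‖ - ‖y‖) • N (‖y‖⁻¹ • y) := by
      simp only [F]
      module
    calc ‖F x - F y‖ ≤ ‖x‖ * ‖N (‖x‖⁻¹ • x) - N (‖y‖⁻¹ • y)‖ + |‖x‖ - ‖y‖| * 1 := by
          rw [h1]
          refine (norm_add_le _ _).trans ?_
          rw [norm_smul, norm_norm, norm_smul, hN1 _ (hunit y hy), Real.norm_eq_abs]
      _ ≤ ‖x‖ * (2 * K / m * ‖‖x‖⁻¹ • x - ‖y‖⁻¹ • y‖) + ‖x - y‖ := by
          rw [mul_one]
          gcongr
          · exact hNL _ (hunit x hx) _ (hunit y hy)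
          · exact abs_norm_sub_norm_le x y
      _ = 2 * K / m * (‖x‖ * ‖‖x‖⁻¹ • x - ‖y‖⁻¹ • y‖) + ‖x - y‖ := by ring
      _ ≤ 2 * K / m * (2 * ‖x - y‖) + ‖x - y‖ := by
          gcongr ?_ + _
          exact mul_le_mul_of_nonneg_left (norm_mul_norm_sub_inv_norm_smul_le x y) (by positivity)
      _ = (4 * K / m + 1) * ‖x - y‖ := by ring
  have hFd : ∀ x, x ≠ 0 → DifferentiableAt ℝ F x := by
    intro x hx
    have h1 : DifferentiableAt ℝ (fun y : E => ‖y‖) x := differentiableAt_id.norm ℝ hx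
    have h2 : DifferentiableAt ℝ (fun y : E => ‖y‖⁻¹ • y) x :=
      (h1.inv (norm_ne_zero_iff.2 hx)).smul differentiableAt_id
    have h3 : DifferentiableAt ℝ (fun y : E => T (‖y‖⁻¹ • y)) x :=
      ((hT.differentiable one_ne_zero) _).comp x h2
    have h4 := (hT0 _ (hunit x hx)).1
    exact h1.smul (((h3.norm ℝ h4).inv (norm_ne_zero_iff.2 h4)).smul h3)
  have hFo : ∀ x, inner ℝ (F x) x = 0 := by
    intro x
    rcases eq_or_ne x 0 with rfl | hx
    · simp
    · have h1 := (hT0 _ (hunit x hx)).2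
      rw [inner_smul_right] at h1
      have h2 := (mul_eq_zero.1 h1).resolve_left (inv_ne_zero (norm_ne_zero_iff.2 hx))
      simp only [F, N, inner_smul_left, h2, mul_zero]
  let _ : MeasurableSpace E := borel E
  have : BorelSpace E := ⟨rfl⟩
  exact hFL.not_odd_finrank_of_tangent hFd hFn hFo hodd

end

theorem exists_isCompact_forall_eq_mul_mul {G : Type*} [Group G] [TopologicalSpace G]
    [IsTopologicalGroup G] [LocallyCompactSpace G] (Γ H : Subgroup G)
    [CompactSpace (MulAction.orbitRel.Quotient ↥Γ (G ⧸ H))] :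
    ∃ C : Set G, IsCompact C ∧ ∀ g : G, ∃ γ ∈ Γ, ∃ c ∈ C, ∃ η ∈ H, g = γ * c * η := by
  have : ContinuousConstSMul ↥Γ (G ⧸ H) := ⟨fun γ => continuous_const_smul (γ : G)⟩
  let π : G → MulAction.orbitRel.Quotient ↥Γ (G ⧸ H) := fun g => Quotient.mk'' (g : G ⧸ H)
  have hopen : IsOpenMap π :=
    (isOpenMap_quotient_mk'_mul (Γ := ↥Γ) (T := G ⧸ H)).comp QuotientGroup.isOpenMap_coe
  have hsurj : Function.Surjective π :=
    Quotient.mk''_surjective.comp QuotientGroup.mk_surjective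
  choose K hK hKn using fun g : G => exists_compact_mem_nhds g
  obtain ⟨t, ht⟩ := CompactSpace.elim_nhds_subcover (X := MulAction.orbitRel.Quotient ↥Γ (G ⧸ H))
    (fun x => π '' K (Function.surjInv hsurj x)) (fun x => by
      have h := hopen.image_mem_nhds (hKn (Function.surjInv hsurj x))
      rwa [Function.surjInv_eq hsurj] at h)
  refine ⟨⋃ x ∈ t, K (Function.surjInv hsurj x), t.isCompact_biUnion fun x _ => hK _, fun g => ?_⟩
  have hg : π g ∈ ⋃ x ∈ t, π '' K (Function.surjInv hsurj x) := by rw [ht]; trivial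
  simp only [Set.mem_iUnion] at hg
  obtain ⟨x, hx, c, hc, hcg⟩ := hg
  have h1 : MulAction.orbitRel ↥Γ (G ⧸ H) (c : G ⧸ H) (g : G ⧸ H) := Quotient.exact hcg
  obtain ⟨γ, hγ⟩ := h1
  have h2 : ((γ : G) * g : G ⧸ H) = (c : G ⧸ H) := hγ
  have h3 := QuotientGroup.eq.1 h2
  refine ⟨(γ : G)⁻¹, Γ.inv_mem γ.2, c, Set.mem_biUnion hx hc, _, H.inv_mem h3, ?_⟩
  group

theorem ProperlyDiscontinuousSMul.finite_setOf_mul_eq_mul {G : Type*} [Group G]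
    [TopologicalSpace G] (Γ H : Subgroup G) [ProperlyDiscontinuousSMul ↥Γ (G ⧸ H)] {A B : Set G}
    (hA : IsCompact A) (hB : IsCompact B) :
    {γ : G | γ ∈ Γ ∧ ∃ a ∈ A, ∃ b ∈ B, ∃ η ∈ H, γ * a = b * η}.Finite := by
  have h := ProperlyDiscontinuousSMul.finite_disjoint_inter_image (Γ := ↥Γ)
    (hA.image (QuotientGroup.continuous_mk (N := H)))
    (hB.image (QuotientGroup.continuous_mk (N := H)))
  refine (h.image Subtype.val).subset ?_
  rintro γ ⟨hγ, a, ha, b, hb, η, hη, hab⟩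
  refine ⟨⟨γ, hγ⟩, ⟨(b : G ⧸ H), ⟨(a : G ⧸ H), ⟨a, ha, rfl⟩, ?_⟩, ⟨b, hb, rfl⟩⟩, rfl⟩
  show ((γ * a : G) : G ⧸ H) = (b : G ⧸ H)
  rw [hab, QuotientGroup.mk_mul_of_mem b hη]

namespace SOC

variable {p q : ℕ}

theorem JC_mul_JC (p q : ℕ) : JC p q * JC p q = 1 := by
  rw [JC, Matrix.diagonal_mul_diagonal, ← Matrix.diagonal_one]
  congr 1
  ext i
  rcases i with i | i <;> simp

theorem JC_conjTranspose (p q : ℕ) : (JC p q)ᴴ = JC p q := by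
  rw [JC, Matrix.diagonal_conjTranspose]
  congr 1
  ext i
  rcases i with i | i <;> simp

/-- The matrix of an element of `SOC p q`. -/
def mat (g : SOC p q) : Matrix (Fin p ⊕ Fin q) (Fin p ⊕ Fin q) ℂ := g.val.val

theorem mat_mul (g h : SOC p q) : mat (g * h) = mat g * mat h := rfl

@[simp] theorem mat_one : mat (1 : SOC p q) = 1 := rfl

theorem mat_transpose_mul (g : SOC p q) : (mat g)ᵀ * JC p q * mat g = JC p q := g.2.1

theorem det_mat (g : SOC p q) : (mat g).det = 1 := g.2.2

theorem mat_inv_mul (g : SOC p q) : mat g⁻¹ * mat g = 1 := by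
  rw [← mat_mul, inv_mul_cancel, mat_one]

theorem mat_mul_inv (g : SOC p q) : mat g * mat g⁻¹ = 1 := by
  rw [← mat_mul, mul_inv_cancel, mat_one]

theorem mat_inv (g : SOC p q) : mat g⁻¹ = JC p q * (mat g)ᵀ * JC p q := by
  have h : (JC p q * (mat g)ᵀ * JC p q) * mat g = 1 := by
    rw [mul_assoc, mul_assoc, ← mul_assoc (mat g)ᵀ, mat_transpose_mul, JC_mul_JC]
  calc mat g⁻¹ = (JC p q * (mat g)ᵀ * JC p q) * mat g * mat g⁻¹ := by rw [h, one_mul]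
    _ = _ := by rw [mul_assoc, mat_mul_inv, mul_one]

theorem mat_mul_transpose (g : SOC p q) : mat g * JC p q * (mat g)ᵀ = JC p q := by
  have h := mat_mul_inv g
  rw [mat_inv] at h
  calc mat g * JC p q * (mat g)ᵀ
      = (mat g * (JC p q * (mat g)ᵀ * JC p q)) * JC p q := by
        simp only [mul_assoc, JC_mul_JC, mul_one]
    _ = _ := by rw [h, one_mul]

/-- The element of `SOC p q` with a given matrix. -/
def ofMatrix (A : Matrix (Fin p ⊕ Fin q) (Fin p ⊕ Fin q) ℂ) (h : Aᵀ * JC p q * A = JC p q)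
    (hd : A.det = 1) : SOC p q :=
  ⟨Matrix.nonsingInvUnit A (by rw [hd]; exact isUnit_one), h, hd⟩

@[simp] theorem mat_ofMatrix (A : Matrix (Fin p ⊕ Fin q) (Fin p ⊕ Fin q) ℂ)
    (h : Aᵀ * JC p q * A = JC p q) (hd : A.det = 1) : mat (ofMatrix A h hd) = A := rfl

theorem isClosedEmbedding_mat : Topology.IsClosedEmbedding (mat : SOC p q → _) := by
  have hemb : Topology.IsEmbedding
      (Units.val : GL (Fin p ⊕ Fin q) ℂ → Matrix (Fin p ⊕ Fin q) (Fin p ⊕ Fin q) ℂ) := by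
    refine Units.isEmbedding_val_mk' (f := fun A => A.det⁻¹ • A.adjugate) ?_ ?_
    · intro A hA
      have hA0 : A.det ≠ 0 := ((Matrix.isUnit_iff_isUnit_det A).1 hA).ne_zero
      have h1 : ContinuousAt (fun A : Matrix (Fin p ⊕ Fin q) (Fin p ⊕ Fin q) ℂ => A.det⁻¹) A :=
        (continuous_id.matrix_det.continuousAt).inv₀ hA0
      exact (h1.smul (continuous_id.matrix_adjugate.continuousAt)).continuousWithinAt
    · intro u
      rw [Matrix.coe_units_inv, Matrix.inv_def, Ring.inverse_eq_inv']
  refine ⟨hemb.comp Topology.IsEmbedding.subtypeVal, ?_⟩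
  have hrange : Set.range (mat : SOC p q → _) =
      {A | Aᵀ * JC p q * A = JC p q} ∩ {A | A.det = 1} := by
    ext A
    constructor
    · rintro ⟨g, rfl⟩
      exact ⟨mat_transpose_mul g, det_mat g⟩
    · rintro ⟨h, hd⟩
      exact ⟨ofMatrix A h hd, rfl⟩
  rw [hrange]
  refine (isClosed_eq ?_ continuous_const).inter (isClosed_eq ?_ continuous_const)
  · fun_prop
  · exact continuous_id.matrix_det

theorem continuous_mat : Continuous (mat : SOC p q → _) := isClosedEmbedding_mat.continuous

theorem continuous_mat_apply (i j : Fin p ⊕ Fin q) : Continuous fun g : SOC p q => mat g i j :=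
  continuous_mat.matrix_elem i j

theorem isCompact_of_bounded {S : Set (SOC p q)} (hS : IsClosed S) {R : ℝ}
    (hR : ∀ g ∈ S, ∀ i j, ‖mat g i j‖ ≤ R) : IsCompact S := by
  have hK : IsCompact {A : Matrix (Fin p ⊕ Fin q) (Fin p ⊕ Fin q) ℂ |
      ∀ i j, A i j ∈ Metric.closedBall (0 : ℂ) R} := by
    have h := isCompact_univ_pi fun _ : Fin p ⊕ Fin q =>
      isCompact_univ_pi fun _ : Fin p ⊕ Fin q => isCompact_closedBall (0 : ℂ) R
    have h2 : (Set.univ.pi fun _ : Fin p ⊕ Fin q => Set.univ.pi fun _ : Fin p ⊕ Fin q =>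
        Metric.closedBall (0 : ℂ) R) = {A | ∀ i j, A i j ∈ Metric.closedBall (0 : ℂ) R} := by
      ext A
      simp [Set.mem_pi]
    rw [h2] at h
    exact h
  refine (isClosedEmbedding_mat.isCompact_preimage hK).of_isClosed_subset hS fun g hg i j => ?_
  simpa using hR g hg i j

theorem exists_bound_of_isCompact {S : Set (SOC p q)} (hS : IsCompact S) :
    ∃ R : ℝ, 0 ≤ R ∧ ∀ g ∈ S, ∀ i j, ‖mat g i j‖ ≤ R := by
  obtain ⟨C, hC⟩ := hS.exists_bound_of_continuousOn
    (f := fun g : SOC p q => ∑ i, ∑ j, ‖mat g i j‖) (Continuous.continuousOn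
      (continuous_finsetSum _ fun i _ => continuous_finsetSum _ fun j _ =>
        (continuous_mat_apply i j).norm))
  refine ⟨|C|, abs_nonneg C, fun g hg i j => ?_⟩
  calc ‖mat g i j‖ ≤ ∑ j, ‖mat g i j‖ :=
        Finset.single_le_sum (f := fun j => ‖mat g i j‖) (fun _ _ => norm_nonneg _)
          (Finset.mem_univ j)
    _ ≤ ∑ i, ∑ j, ‖mat g i j‖ :=
        Finset.single_le_sum (f := fun i => ∑ j, ‖mat g i j‖)
          (fun _ _ => Finset.sum_nonneg fun _ _ => norm_nonneg _) (Finset.mem_univ i)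
    _ ≤ C := (Real.le_norm_self _).trans (hC g hg)
    _ ≤ |C| := le_abs_self C

instance : LocallyCompactSpace (SOC p q) := by
  have : LocallyCompactSpace (Matrix (Fin p ⊕ Fin q) (Fin p ⊕ Fin q) ℂ) :=
    inferInstanceAs (LocallyCompactSpace (Fin p ⊕ Fin q → Fin p ⊕ Fin q → ℂ))
  exact isClosedEmbedding_mat.locallyCompactSpace

theorem mem_realForm_iff (g : SOC p q) : g ∈ SOCrealForm p q ↔ ∀ i j, (mat g i j).im = 0 :=
  Iff.rfl

theorem conjTranspose_eq_transpose_of_mem {η : SOC p q} (hη : η ∈ SOCrealForm p q) :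
    (mat η)ᴴ = (mat η)ᵀ := by
  ext i j
  exact Complex.conj_eq_iff_im.2 (hη j i)

theorem isClosed_realForm : IsClosed (SOCrealForm p q : Set (SOC p q)) := by
  have : (SOCrealForm p q : Set (SOC p q)) = ⋂ i, ⋂ j, {g | (mat g i j).im = 0} := by
    ext g
    simp only [Set.mem_iInter, SetLike.mem_coe, mem_realForm_iff]
    rfl
  rw [this]
  exact isClosed_iInter fun i => isClosed_iInter fun j =>
    isClosed_eq (Complex.continuous_im.comp (continuous_mat_apply i j)) continuous_const

variable (p q) in
/-- The elements of `SOC p q` whose matrix is unitary. -/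
def unitaries : Subgroup (SOC p q) where
  carrier := {k | (mat k)ᴴ * mat k = 1}
  one_mem' := by simp
  mul_mem' := by
    intro a b (ha : (mat a)ᴴ * mat a = 1) (hb : (mat b)ᴴ * mat b = 1)
    show (mat (a * b))ᴴ * mat (a * b) = 1
    rw [mat_mul, conjTranspose_mul, mul_assoc, ← mul_assoc (mat a)ᴴ, ha, one_mul, hb]
  inv_mem' := by
    intro a (ha : (mat a)ᴴ * mat a = 1)
    show (mat a⁻¹)ᴴ * mat a⁻¹ = 1
    have h1 : mat a⁻¹ = (mat a)ᴴ := by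
      calc mat a⁻¹ = (mat a)ᴴ * mat a * mat a⁻¹ := by rw [ha, one_mul]
        _ = (mat a)ᴴ := by rw [mul_assoc, mat_mul_inv, mul_one]
    rw [h1, conjTranspose_conjTranspose, ← h1, mat_mul_inv]

theorem mem_unitaries_iff (k : SOC p q) : k ∈ unitaries p q ↔ (mat k)ᴴ * mat k = 1 := Iff.rfl

theorem norm_apply_le_one_of_mem_unitaries {k : SOC p q} (hk : k ∈ unitaries p q)
    (i j : Fin p ⊕ Fin q) : ‖mat k i j‖ ≤ 1 := by
  have h : mat k ∈ Matrix.unitaryGroup (Fin p ⊕ Fin q) ℂ := by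
    rw [Matrix.mem_unitaryGroup_iff']
    exact hk
  exact entry_norm_bound_of_unitary h i j

theorem isCompact_unitaries : IsCompact (unitaries p q : Set (SOC p q)) := by
  refine isCompact_of_bounded (R := 1) ?_ fun k hk i j => norm_apply_le_one_of_mem_unitaries hk i j
  exact isClosed_eq (continuous_mat.matrix_conjTranspose.mul continuous_mat) continuous_const

end SOC

theorem exists_unit_apply_apply_eq_neg_smul {E : Type*} [NormedAddCommGroup E]
    [InnerProductSpace ℝ E] [FiniteDimensional ℝ E] {B : E →ₗ[ℝ] E}
    (hB : ∀ x y, inner ℝ (B x) y = -inner ℝ x (B y)) (h0 : B ≠ 0) :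
    ∃ a b : E, ∃ l : ℝ, l ≠ 0 ∧ ‖a‖ = 1 ∧ ‖b‖ = 1 ∧ inner ℝ a b = 0 ∧
      B a = l • b ∧ B b = -(l • a) := by
  have hS : (-(B ∘ₗ B)).IsSymmetric := by
    intro x y
    simp only [LinearMap.neg_apply, LinearMap.comp_apply, inner_neg_left, inner_neg_right, hB,
      neg_neg]
  have hne : ∃ i, hS.eigenvalues rfl i ≠ 0 := by
    by_contra! hall
    apply h0
    ext x
    have h1 : -(B ∘ₗ B) = 0 := by
      refine (hS.eigenvectorBasis rfl).toBasis.ext fun i => ?_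
      have h := hS.apply_eigenvectorBasis rfl i
      rw [hall i] at h
      simpa using h
    have h2 : inner ℝ (B x) (B x) = 0 := by
      rw [hB]
      have : B (B x) = 0 := by simpa using LinearMap.congr_fun h1 x
      rw [this, inner_zero_right, neg_zero]
    simpa using h2
  obtain ⟨i, hi⟩ := hne
  set a := hS.eigenvectorBasis rfl i with ha
  have ha1 : ‖a‖ = 1 := (hS.eigenvectorBasis rfl).orthonormal.1 i
  have hSa : -(B (B a)) = hS.eigenvalues rfl i • a := by
    simpa using hS.apply_eigenvectorBasis rfl i
  have hl : ‖B a‖ ^ 2 = hS.eigenvalues rfl i := by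
    rw [← real_inner_self_eq_norm_sq, hB, ← inner_neg_right, hSa, inner_smul_right,
      real_inner_self_eq_norm_sq, ha1]
    simp
  have hl0 : ‖B a‖ ≠ 0 := by
    intro h
    rw [h] at hl
    exact hi (by rw [← hl]; simp)
  have haa : inner ℝ a (B a) = 0 := by
    have := hB a a
    rw [real_inner_comm] at this
    linarith
  refine ⟨a, ‖B a‖⁻¹ • B a, ‖B a‖, hl0, ha1, ?_, ?_, ?_, ?_⟩
  · rw [norm_smul, norm_inv, norm_norm, inv_mul_cancel₀ hl0]
  · rw [inner_smul_right, haa, mul_zero]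
  · rw [smul_smul, mul_inv_cancel₀ hl0, one_smul]
  · rw [map_smul, ← neg_eq_iff_eq_neg, ← smul_neg, hSa, ← hl, smul_smul]
    congr 1
    field_simp

theorem exists_orthonormal_isotropic (n : ℕ) : ∀ {E : Type*} [NormedAddCommGroup E]
    [InnerProductSpace ℝ E] [FiniteDimensional ℝ E] {B : E →ₗ[ℝ] E}
    (_ : ∀ x y, inner ℝ (B x) y = -inner ℝ x (B y)) {p q : ℕ}
    (_ : Module.finrank ℝ E = p + q) (_ : p + q = n)
    (_ : p ≤ q + Module.finrank ℝ (LinearMap.ker B))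
    (_ : q ≤ p + Module.finrank ℝ (LinearMap.ker B)),
    ∃ (f : Fin p → E) (g : Fin q → E), Orthonormal ℝ (Sum.elim f g) ∧
      (∀ i j, inner ℝ (f i) (B (f j)) = 0) ∧ ∀ i j, inner ℝ (g i) (B (g j)) = 0 := by
  induction n using Nat.strong_induction_on with
  | _ n ih =>
  intro E _ _ _ B hB p q hE hn hp hq
  by_cases h0 : B = 0
  · let b := (stdOrthonormalBasis ℝ E).reindex ((finCongr hE).trans finSumFinEquiv.symm)
    refine ⟨b ∘ Sum.inl, b ∘ Sum.inr, ?_, by simp [h0], by simp [h0]⟩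
    rw [Sum.elim_comp_inl_inr]
    exact b.orthonormal
  obtain ⟨a, b, l, hl, ha, hb, hab, hBa, hBb⟩ := exists_unit_apply_apply_eq_neg_smul hB h0
  have hba : inner ℝ b a = 0 := by rw [real_inner_comm]; exact hab
  let V : Submodule ℝ E := Submodule.span ℝ {a, b}
  have hmem : ∀ x, x ∈ Vᗮ ↔ inner ℝ a x = 0 ∧ inner ℝ b x = 0 := by
    intro x
    rw [Submodule.mem_orthogonal]
    constructor
    · intro h
      exact ⟨h a (Submodule.subset_span (by simp)), h b (Submodule.subset_span (by simp))⟩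
    · rintro ⟨h1, h2⟩ u hu
      obtain ⟨s, t, rfl⟩ := Submodule.mem_span_pair.1 hu
      rw [inner_add_left, inner_smul_left, inner_smul_left, h1, h2]
      simp
  have hinv : ∀ x ∈ Vᗮ, B x ∈ Vᗮ := by
    intro x hx
    rw [hmem] at hx ⊢
    constructor
    · have h1 : inner ℝ a (B x) = -inner ℝ (B a) x := by rw [hB, neg_neg]
      rw [h1, hBa, inner_smul_left, hx.2]
      simp
    · have h1 : inner ℝ b (B x) = -inner ℝ (B b) x := by rw [hB, neg_neg]
      rw [h1, hBb, inner_neg_left, inner_smul_left, hx.1]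
      simp
  have hker : LinearMap.ker B ≤ Vᗮ := by
    intro x hx
    rw [LinearMap.mem_ker] at hx
    have h1 : inner ℝ (B a) x = 0 := by rw [hB, hx, inner_zero_right, neg_zero]
    have h2 : inner ℝ (B b) x = 0 := by rw [hB, hx, inner_zero_right, neg_zero]
    rw [hBa, inner_smul_left] at h1
    rw [hBb, inner_neg_left, inner_smul_left, neg_eq_zero] at h2
    rw [hmem]
    exact ⟨(mul_eq_zero.1 h2).resolve_left (by simpa using hl),
      (mul_eq_zero.1 h1).resolve_left (by simpa using hl)⟩
  have hV : Module.finrank ℝ V = 2 := by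
    have hon : Orthonormal ℝ ![a, b] := by
      rw [orthonormal_iff_ite]
      intro i j
      fin_cases i <;> fin_cases j <;> simp [ha, hb, hab, hba]
    have h := finrank_span_eq_card hon.linearIndependent
    rw [Matrix.range_cons, Matrix.range_cons, Matrix.range_empty, Set.union_empty,
      Set.singleton_union] at h
    simpa using h
  have hVo := Submodule.finrank_add_finrank_orthogonal V
  have hkle := Submodule.finrank_mono hker
  let B' : Vᗮ →ₗ[ℝ] Vᗮ := B.restrict hinv
  have hker' : Module.finrank ℝ (LinearMap.ker B') = Module.finrank ℝ (LinearMap.ker B) := by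
    have h1 : LinearMap.ker B' = (LinearMap.ker B).comap Vᗮ.subtype := by
      ext x
      simp [B', LinearMap.mem_ker, LinearMap.restrict_apply, ← Subtype.coe_inj]
    rw [h1]
    exact (Submodule.comapSubtypeEquivOfLe hker).finrank_eq
  obtain ⟨p, rfl⟩ : ∃ p', p = p' + 1 := ⟨p - 1, by omega⟩
  obtain ⟨q, rfl⟩ : ∃ q', q = q' + 1 := ⟨q - 1, by omega⟩
  obtain ⟨f, g, hon, hf, hg⟩ := ih (p + q) (by omega) (E := Vᗮ) (B := B')
    (fun x y => hB x y) (p := p) (q := q) (by omega) rfl (by omega) (by omega)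
  have hfa : ∀ i, inner ℝ a (f i : E) = 0 := fun i => ((hmem _).1 (f i).2).1
  have hfb : ∀ i, inner ℝ b (f i : E) = 0 := fun i => ((hmem _).1 (f i).2).2
  have hga : ∀ i, inner ℝ a (g i : E) = 0 := fun i => ((hmem _).1 (g i).2).1
  have hgb : ∀ i, inner ℝ b (g i : E) = 0 := fun i => ((hmem _).1 (g i).2).2
  have hfa' : ∀ i, inner ℝ (f i : E) a = 0 := fun i => by rw [real_inner_comm]; exact hfa i
  have hfb' : ∀ i, inner ℝ (f i : E) b = 0 := fun i => by rw [real_inner_comm]; exact hfb i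
  have hga' : ∀ i, inner ℝ (g i : E) a = 0 := fun i => by rw [real_inner_comm]; exact hga i
  have hgb' : ∀ i, inner ℝ (g i : E) b = 0 := fun i => by rw [real_inner_comm]; exact hgb i
  rw [orthonormal_iff_ite] at hon
  refine ⟨Fin.cons a fun i => (f i : E), Fin.cons b fun i => (g i : E), ?_, ?_, ?_⟩
  · rw [orthonormal_iff_ite]
    rintro (i | i) (j | j) <;> refine Fin.cases ?_ (fun i => ?_) i <;>
      refine Fin.cases ?_ (fun j => ?_) j
    · simp [ha]
    · simp [hfa, (Fin.succ_ne_zero _).symm]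
    · simp [hfa']
    · simpa using hon (Sum.inl i) (Sum.inl j)
    · simp [hab]
    · simp [hga]
    · simp [hfb']
    · simpa using hon (Sum.inl i) (Sum.inr j)
    · simp [hba]
    · simp [hfb]
    · simp [hga']
    · simpa using hon (Sum.inr i) (Sum.inl j)
    · simp [hb]
    · simp [hgb, (Fin.succ_ne_zero _).symm]
    · simp [hgb']
    · simpa using hon (Sum.inr i) (Sum.inr j)
  · intro i j
    refine Fin.cases ?_ (fun i => ?_) i <;> refine Fin.cases ?_ (fun j => ?_) j
    · simp [hBa, hab, inner_smul_right]
    · simpa using ((hmem _).1 (hinv _ (f j).2)).1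
    · simp [hBa, hfb', inner_smul_right]
    · simpa [B'] using hf i j
  · intro i j
    refine Fin.cases ?_ (fun i => ?_) i <;> refine Fin.cases ?_ (fun j => ?_) j
    · simp [hBb, hba, inner_smul_right]
    · simpa using ((hmem _).1 (hinv _ (g j).2)).2
    · simp [hBb, hga', inner_smul_right]
    · simpa [B'] using hg i j

section

open scoped ComplexOrder

theorem exists_orthogonal_transpose_mul_mul_apply_eq_zero {p q : ℕ} (hp : 0 < p)
    {B : Matrix (Fin p ⊕ Fin q) (Fin p ⊕ Fin q) ℝ} (hB : Bᵀ = -B)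
    {W : Submodule ℝ (Fin p ⊕ Fin q → ℝ)} (hW : ∀ x ∈ W, B *ᵥ x = 0)
    (h1 : p ≤ q + Module.finrank ℝ W) (h2 : q ≤ p + Module.finrank ℝ W) :
    ∃ O : Matrix (Fin p ⊕ Fin q) (Fin p ⊕ Fin q) ℝ, Oᵀ * O = 1 ∧ O.det = 1 ∧
      (∀ i j, (Oᵀ * B * O) (Sum.inl i) (Sum.inl j) = 0) ∧
      ∀ i j, (Oᵀ * B * O) (Sum.inr i) (Sum.inr j) = 0 := by
  let T := Matrix.toEuclideanLin B
  have hin : ∀ x y : EuclideanSpace ℝ (Fin p ⊕ Fin q), inner ℝ x y = x.ofLp ⬝ᵥ y.ofLp := by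
    intro x y
    rw [EuclideanSpace.inner_eq_star_dotProduct, dotProduct_comm]
    simp
  have hT : ∀ x y, inner ℝ (T x) y = -inner ℝ x (T y) := by
    intro x y
    simp only [hin, T, Matrix.toLpLin_apply]
    rw [dotProduct_mulVec, ← mulVec_transpose, hB, neg_mulVec, neg_dotProduct, neg_neg]
  have hker : Module.finrank ℝ W ≤ Module.finrank ℝ (LinearMap.ker T) := by
    rw [← LinearEquiv.finrank_map_eq (WithLp.linearEquiv 2 ℝ (Fin p ⊕ Fin q → ℝ)).symm W]
    refine Submodule.finrank_mono ?_
    rintro _ ⟨x, hx, rfl⟩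
    rw [LinearMap.mem_ker]
    simp [T, Matrix.toLpLin_apply, hW x hx]
  obtain ⟨f, g, hon, hf, hg⟩ := exists_orthonormal_isotropic (p + q) hT (p := p) (q := q)
    (by simp) rfl (by omega) (by omega)
  rw [orthonormal_iff_ite] at hon
  let v : Fin p ⊕ Fin q → EuclideanSpace ℝ (Fin p ⊕ Fin q) := Sum.elim f g
  let O : Matrix (Fin p ⊕ Fin q) (Fin p ⊕ Fin q) ℝ := Matrix.of fun i j => (v j).ofLp i
  have hO : Oᵀ * O = 1 := by
    ext i j
    rw [Matrix.one_apply, ← hon i j, hin]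
    rfl
  have hBO : ∀ i j, (Oᵀ * B * O) i j = inner ℝ (v i) (T (v j)) := by
    intro i j
    rw [hin, mul_assoc, Matrix.mul_apply_eq_vecMul, Matrix.toLpLin_apply]
    rfl
  have hdet : O.det * O.det = 1 := by
    have := congrArg Matrix.det hO
    rwa [det_mul, det_transpose, det_one] at this
  let s : Fin p ⊕ Fin q → ℝ := fun i => if i = Sum.inl ⟨0, hp⟩ then O.det else 1
  have hs : ∀ i, s i * s i = 1 := by
    intro i
    by_cases h : i = Sum.inl ⟨0, hp⟩ <;> simp [s, h, hdet]
  have hOs : ∀ i j, ((O * diagonal s)ᵀ * B * (O * diagonal s)) i j =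
      s i * (Oᵀ * B * O) i j * s j := by
    intro i j
    have : (O * diagonal s)ᵀ * B * (O * diagonal s) =
        diagonal s * (Oᵀ * B * O) * diagonal s := by
      rw [transpose_mul, diagonal_transpose]
      simp only [mul_assoc]
    rw [this, mul_diagonal, diagonal_mul]
  refine ⟨O * diagonal s, ?_, ?_, fun i j => ?_, fun i j => ?_⟩
  · rw [transpose_mul, diagonal_transpose, mul_assoc, ← mul_assoc Oᵀ, hO, one_mul,
      diagonal_mul_diagonal, ← diagonal_one]
    congr 1
    ext i
    exact hs i
  · rw [det_mul, det_diagonal]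
    simp [s, hdet]
  · rw [hOs, hBO]
    simp [v, hf]
  · rw [hOs, hBO]
    simp [v, hg]

/-- Injectivity of the Sylvester operator attached to two positive definite matrices,
on Hermitian matrices. -/
theorem Matrix.IsHermitian.eq_zero_of_mul_add_mul_eq_zero {n : Type*} [Fintype n] [DecidableEq n]
    {X Y Z : Matrix n n ℂ} (hZ : Z.IsHermitian) (hX : X.PosDef) (hY : Y.PosDef)
    (h : X * Z + Z * Y = 0) : Z = 0 := by
  rw [← hZ.eigenvalues_eq_zero_iff]
  ext i
  set v : n → ℂ := (hZ.eigenvectorBasis i).ofLp with hv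
  have hv0 : v ≠ 0 := by
    intro h0
    have := hZ.eigenvectorBasis.orthonormal.ne_zero i
    exact this (by ext j; exact congrFun h0 j)
  have hZv : Z *ᵥ v = (hZ.eigenvalues i : ℂ) • v := by
    have := hZ.mulVec_eigenvectorBasis i
    simpa using this
  have hZv' : star v ᵥ* Z = (hZ.eigenvalues i : ℂ) • star v := by
    have h1 := congrArg star hZv
    rw [star_mulVec, hZ.eq, star_smul] at h1
    simpa using h1
  have h1 : star v ⬝ᵥ (X * Z + Z * Y) *ᵥ v = 0 := by rw [h]; simp
  rw [add_mulVec, dotProduct_add, ← mulVec_mulVec, hZv, mulVec_smul, dotProduct_smul,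
    ← mulVec_mulVec, dotProduct_mulVec _ Z, hZv', smul_dotProduct, ← smul_add, smul_eq_mul] at h1
  have h2 : 0 < star v ⬝ᵥ X *ᵥ v + star v ⬝ᵥ Y *ᵥ v :=
    add_pos (hX.dotProduct_mulVec_pos hv0) (hY.dotProduct_mulVec_pos hv0)
  simpa using (mul_eq_zero.1 h1).resolve_right h2.ne'

theorem Matrix.PosDef.eq_of_mul_self_eq {n : Type*} [Fintype n] [DecidableEq n]
    {X Y : Matrix n n ℂ} (hX : X.PosDef) (hY : Y.PosDef) (h : X * X = Y * Y) : X = Y := by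
  rw [← sub_eq_zero]
  refine (hX.isHermitian.sub hY.isHermitian).eq_zero_of_mul_add_mul_eq_zero hX hY ?_
  rw [mul_sub, sub_mul, h]
  abel

open scoped MatrixOrder in
theorem Matrix.PosDef.exists_mul_self_eq {n : Type*} [Fintype n] [DecidableEq n]
    {X : Matrix n n ℂ} (hX : X.PosDef) : ∃ S : Matrix n n ℂ, S.PosDef ∧ S * S = X := by
  have h0 : (0 : Matrix n n ℂ) ≤ X := by
    rw [Matrix.nonneg_iff_posSemidef]; exact hX.posSemidef
  have hS : CFC.sqrt X * CFC.sqrt X = X := CFC.sqrt_mul_sqrt_self X h0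
  refine ⟨CFC.sqrt X, ?_, hS⟩
  have hpos : (CFC.sqrt X).PosSemidef := Matrix.nonneg_iff_posSemidef.1 (CFC.sqrt_nonneg X)
  refine hpos.posDef_iff_det_ne_zero.2 fun hd => ?_
  have := congrArg Matrix.det hS
  rw [det_mul, hd, zero_mul] at this
  exact hX.det_pos.ne this

end

section

open scoped ComplexOrder

namespace SOC

/-- A diagonal square root of `JC p q`. -/
def sqrtJC (p q : ℕ) : Matrix (Fin p ⊕ Fin q) (Fin p ⊕ Fin q) ℂ :=
  Matrix.diagonal (Sum.elim (fun _ => 1) (fun _ => Complex.I))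

variable {p q : ℕ}

theorem sqrtJC_transpose : (sqrtJC p q)ᵀ = sqrtJC p q := Matrix.diagonal_transpose _

theorem sqrtJC_mul_self : sqrtJC p q * sqrtJC p q = JC p q := by
  rw [sqrtJC, JC, diagonal_mul_diagonal]
  congr 1
  ext i
  rcases i with i | i <;> simp

theorem sqrtJC_conjTranspose_transpose : (sqrtJC p q)ᴴᵀ = (sqrtJC p q)ᴴ := by
  rw [sqrtJC, Matrix.diagonal_conjTranspose, Matrix.diagonal_transpose]

theorem conjTranspose_sqrtJC_mul : (sqrtJC p q)ᴴ * sqrtJC p q = 1 := by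
  rw [sqrtJC, Matrix.diagonal_conjTranspose, diagonal_mul_diagonal, ← diagonal_one]
  congr 1
  ext i
  rcases i with i | i <;> simp

theorem sqrtJC_mul_conjTranspose : sqrtJC p q * (sqrtJC p q)ᴴ = 1 :=
  mul_eq_one_comm.1 conjTranspose_sqrtJC_mul

theorem conjTranspose_sqrtJC_mul_JC : (sqrtJC p q)ᴴ * JC p q = sqrtJC p q := by
  rw [← sqrtJC_mul_self, ← mul_assoc, conjTranspose_sqrtJC_mul, one_mul]

theorem JC_mul_sqrtJC : JC p q * sqrtJC p q = (sqrtJC p q)ᴴ := by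
  rw [sqrtJC, JC, diagonal_mul_diagonal, Matrix.diagonal_conjTranspose]
  congr 1
  ext i
  rcases i with i | i <;> simp

theorem det_conjTranspose_sqrtJC_mul : (sqrtJC p q)ᴴ.det * (sqrtJC p q).det = 1 := by
  rw [← det_mul, conjTranspose_sqrtJC_mul, det_one]

theorem map_ofReal_mul {ι : Type*} [Fintype ι] (A B : Matrix ι ι ℝ) :
    (A * B).map Complex.ofReal = A.map Complex.ofReal * B.map Complex.ofReal :=
  Matrix.map_mul (f := Complex.ofRealHom)

/-- The element of `SOC p q` attached to a real rotation. -/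
def ofRotation (O : Matrix (Fin p ⊕ Fin q) (Fin p ⊕ Fin q) ℝ) (hO : Oᵀ * O = 1)
    (hd : O.det = 1) : SOC p q :=
  ofMatrix ((sqrtJC p q)ᴴ * O.map Complex.ofReal * sqrtJC p q) (by
    have hO' : (O.map Complex.ofReal)ᵀ * O.map Complex.ofReal = 1 := by
      rw [← Matrix.transpose_map, ← map_ofReal_mul, hO]
      simp
    calc ((sqrtJC p q)ᴴ * O.map Complex.ofReal * sqrtJC p q)ᵀ * JC p q *
          ((sqrtJC p q)ᴴ * O.map Complex.ofReal * sqrtJC p q)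
        = sqrtJC p q * ((O.map Complex.ofReal)ᵀ * (((sqrtJC p q)ᴴ * JC p q) * (sqrtJC p q)ᴴ) *
            O.map Complex.ofReal) * sqrtJC p q := by
          rw [transpose_mul, transpose_mul, sqrtJC_transpose, sqrtJC_conjTranspose_transpose]
          simp only [mul_assoc]
      _ = JC p q := by
          rw [conjTranspose_sqrtJC_mul_JC, sqrtJC_mul_conjTranspose, mul_one, hO', mul_one,
            sqrtJC_mul_self])
    (by
      have h1 : (O.map Complex.ofReal).det = 1 := by
        have := RingHom.map_det Complex.ofRealHom O
        rw [hd, map_one] at this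
        exact this.symm
      rw [det_mul, det_mul, h1, mul_one, det_conjTranspose_sqrtJC_mul])

theorem mat_ofRotation (O : Matrix (Fin p ⊕ Fin q) (Fin p ⊕ Fin q) ℝ) (hO : Oᵀ * O = 1)
    (hd : O.det = 1) :
    mat (ofRotation O hO hd) = (sqrtJC p q)ᴴ * O.map Complex.ofReal * sqrtJC p q := rfl

theorem map_ofReal_conjTranspose (O : Matrix (Fin p ⊕ Fin q) (Fin p ⊕ Fin q) ℝ) :
    (O.map Complex.ofReal)ᴴ = Oᵀ.map Complex.ofReal := by
  ext i j
  simp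

theorem ofRotation_mem_unitaries (O : Matrix (Fin p ⊕ Fin q) (Fin p ⊕ Fin q) ℝ) (hO : Oᵀ * O = 1)
    (hd : O.det = 1) : ofRotation O hO hd ∈ unitaries p q := by
  have hO' : (O.map Complex.ofReal)ᴴ * O.map Complex.ofReal = 1 := by
    rw [map_ofReal_conjTranspose, ← map_ofReal_mul, hO]
    simp
  rw [mem_unitaries_iff, mat_ofRotation]
  calc ((sqrtJC p q)ᴴ * O.map Complex.ofReal * sqrtJC p q)ᴴ *
          ((sqrtJC p q)ᴴ * O.map Complex.ofReal * sqrtJC p q)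
      = (sqrtJC p q)ᴴ * ((O.map Complex.ofReal)ᴴ * (sqrtJC p q * (sqrtJC p q)ᴴ) *
          O.map Complex.ofReal) * sqrtJC p q := by
        rw [conjTranspose_mul, conjTranspose_mul, conjTranspose_conjTranspose]
        simp only [mul_assoc]
    _ = 1 := by
        rw [sqrtJC_mul_conjTranspose, mul_one, hO', mul_one, conjTranspose_sqrtJC_mul]

theorem posDef_conjTranspose_mul_mat (g : SOC p q) : ((mat g)ᴴ * mat g).PosDef := by
  refine Matrix.PosDef.conjTranspose_mul_self _ ?_
  refine Matrix.mulVec_injective_of_isUnit ?_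
  rw [Matrix.isUnit_iff_isUnit_det, det_mat]
  exact isUnit_one

/-- A symmetric positive definite element of the complex orthogonal group is the square of
an element of the real form. -/
theorem exists_realForm_mul_self_eq {Q : Matrix (Fin p ⊕ Fin q) (Fin p ⊕ Fin q) ℂ} (hQ : Q.PosDef)
    (hsymm : Qᵀ = Q) (hJ : Q * JC p q * Q = JC p q) (hd : Q.det = 1) :
    ∃ η ∈ SOCrealForm p q, (mat η)ᴴ * mat η = Q := by
  obtain ⟨S, hS, hSQ⟩ := hQ.exists_mul_self_eq
  have hST : Sᵀ = S := by
    refine hS.transpose.eq_of_mul_self_eq hS ?_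
    rw [← transpose_mul, hSQ, hsymm]
  have hSdet : S.det ≠ 0 := hS.det_pos.ne'
  have hSu : IsUnit S.det := isUnit_iff_ne_zero.2 hSdet
  have hJS : JC p q * S * JC p q = S⁻¹ := by
    refine Matrix.PosDef.eq_of_mul_self_eq ?_ hS.inv ?_
    · have h := hS.conjTranspose_mul_mul_same (B := JC p q) (Matrix.mulVec_injective_of_isUnit
        (IsUnit.of_mul_eq_one _ (JC_mul_JC p q)))
      rwa [JC_conjTranspose] at h
    · have h1 : JC p q * S * JC p q * (JC p q * S * JC p q) = JC p q * Q * JC p q := by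
        rw [← hSQ]
        simp only [mul_assoc]
        rw [← mul_assoc (JC p q) (JC p q), JC_mul_JC, one_mul]
      have h2 : S⁻¹ * S⁻¹ = Q⁻¹ := by rw [← Matrix.mul_inv_rev, hSQ]
      rw [h1, h2]
      refine (Matrix.inv_eq_left_inv ?_).symm
      rw [mul_assoc, mul_assoc, ← mul_assoc Q, hJ, JC_mul_JC]
  have hdet : S.det = 1 := by
    have h1 : S.det * S.det = 1 := by rw [← det_mul, hSQ, hd]
    rcases mul_self_eq_one_iff.1 h1 with h | h
    · exact h
    · have := hS.det_pos
      rw [h] at this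
      simp at this
      exact absurd this (by norm_num [Complex.lt_def])
  have hSJS : Sᵀ * JC p q * S = JC p q := by
    rw [hST]
    calc S * JC p q * S = S * (JC p q * S * JC p q) * JC p q := by
          simp only [mul_assoc, JC_mul_JC, mul_one]
      _ = JC p q := by rw [hJS, Matrix.mul_nonsing_inv _ hSu, one_mul]
  refine ⟨ofMatrix S hSJS hdet, ?_, ?_⟩
  · rw [mem_realForm_iff]
    intro i j
    rw [← Complex.conj_eq_iff_im]
    have h1 := congrFun₂ hS.isHermitian j i
    have h2 := congrFun₂ hST j i
    rw [mat_ofMatrix]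
    rw [conjTranspose_apply] at h1
    rw [transpose_apply] at h2
    exact h1.trans h2.symm
  · rw [mat_ofMatrix, hS.isHermitian.eq, hSQ]

theorem exists_mul_mul_eq_of_fixed {d : ℂ} (hp : 0 < p) (g : SOC p q)
    (W : Submodule ℝ (Fin p ⊕ Fin q → ℝ))
    (hW : ∀ x ∈ W, ((mat g)ᴴ * mat g) *ᵥ (fun i => (x i : ℂ)) = fun i => (x i : ℂ)) (hd0 : d ≠ 0)
    (hd : ∀ x ∈ W, sqrtJC p q *ᵥ (fun i => (x i : ℂ)) = d • fun i => (x i : ℂ))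
    (h1 : p ≤ q + Module.finrank ℝ W) (h2 : q ≤ p + Module.finrank ℝ W) :
    ∃ k₁ ∈ unitaries p q, ∃ η ∈ SOCrealForm p q, ∃ k₂ ∈ unitaries p q, g = k₁ * η * k₂ := by
  set D := sqrtJC p q with hD
  set P := (mat g)ᴴ * mat g with hP
  have hPpd : P.PosDef := posDef_conjTranspose_mul_mat g
  set P' := D * P * Dᴴ with hP'
  have hP'pd : P'.PosDef := by
    have h := hPpd.conjTranspose_mul_mul_same (B := Dᴴ) (Matrix.mulVec_injective_of_isUnit
      (IsUnit.of_mul_eq_one _ conjTranspose_sqrtJC_mul))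
    rwa [conjTranspose_conjTranspose] at h
  have hPJ : Pᵀ * JC p q * P = JC p q := by
    have hbar : (mat g)ᴴᵀ * JC p q * (mat g)ᴴ = JC p q := by
      have := congrArg conjTranspose (mat_mul_transpose g)
      rw [conjTranspose_mul, conjTranspose_mul, JC_conjTranspose, ← mul_assoc] at this
      exact this
    calc Pᵀ * JC p q * P = (mat g)ᵀ * ((mat g)ᴴᵀ * JC p q * (mat g)ᴴ) * mat g := by
          rw [hP, transpose_mul]
          simp only [mul_assoc]
      _ = JC p q := by rw [hbar, mat_transpose_mul]
  have hP'T : P'ᵀ * P' = 1 := by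
    calc P'ᵀ * P' = Dᴴ * (Pᵀ * (D * D) * P) * Dᴴ := by
          rw [hP', transpose_mul, transpose_mul, hD, sqrtJC_transpose,
            sqrtJC_conjTranspose_transpose]
          simp only [mul_assoc]
      _ = 1 := by
          rw [hD, sqrtJC_mul_self, hPJ, conjTranspose_sqrtJC_mul_JC, sqrtJC_mul_conjTranspose]
  let B : Matrix (Fin p ⊕ Fin q) (Fin p ⊕ Fin q) ℝ := P'.map Complex.im
  have hBT : Bᵀ = -B := by
    ext i j
    have := congrFun₂ hP'pd.isHermitian i j
    rw [conjTranspose_apply] at this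
    show (P' j i).im = -(P' i j).im
    rw [← this]
    simp
  have hBW : ∀ x ∈ W, B *ᵥ x = 0 := by
    intro x hx
    have hDx : Dᴴ *ᵥ (fun i => (x i : ℂ)) = d⁻¹ • fun i => (x i : ℂ) := by
      have h3 : Dᴴ *ᵥ (D *ᵥ (fun i => (x i : ℂ))) = fun i => (x i : ℂ) := by
        rw [mulVec_mulVec, hD, conjTranspose_sqrtJC_mul, one_mulVec]
      rw [hd x hx, mulVec_smul] at h3
      rw [eq_inv_smul_iff₀ hd0]
      exact h3
    have h4 : P' *ᵥ (fun i => (x i : ℂ)) = fun i => (x i : ℂ) := by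
      rw [hP', ← mulVec_mulVec, hDx, ← mulVec_mulVec, mulVec_smul, mulVec_smul, hW x hx, hd x hx,
        smul_smul, inv_mul_cancel₀ hd0, one_smul]
    ext i
    have h5 := congrArg Complex.im (congrFun h4 i)
    simpa [mulVec, dotProduct, B] using h5
  obtain ⟨O, hO, hOd, hOl, hOr⟩ :=
    exists_orthogonal_transpose_mul_mul_apply_eq_zero hp hBT hBW h1 h2
  set Oc := O.map Complex.ofReal with hOc
  have hOcT : Ocᴴ = Ocᵀ := by rw [hOc, map_ofReal_conjTranspose, transpose_map]
  have hOO : Ocᵀ * Oc = 1 := by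
    rw [hOc, ← transpose_map, ← map_ofReal_mul, hO]
    simp
  have hOO' : Oc * Ocᵀ = 1 := mul_eq_one_comm.1 hOO
  set X := Ocᵀ * P' * Oc with hX
  have hXpd : X.PosDef := by
    have h := hP'pd.conjTranspose_mul_mul_same (B := Oc) (Matrix.mulVec_injective_of_isUnit
      (IsUnit.of_mul_eq_one _ hOO'))
    rwa [hOcT] at h
  have hXT : Xᵀ * X = 1 := by
    calc Xᵀ * X = Ocᵀ * (P'ᵀ * (Oc * Ocᵀ) * P') * Oc := by
          rw [hX, transpose_mul, transpose_mul, transpose_transpose]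
          simp only [mul_assoc]
      _ = 1 := by rw [hOO', mul_one, hP'T, mul_one, hOO]
  have hXT' : X * Xᵀ = 1 := mul_eq_one_comm.1 hXT
  have hanti : JC p q * X * JC p q - JC p q * Xᵀ * JC p q = Xᵀ - X := by
    have h3 : X - Xᵀ = (2 * Complex.I) • (Oᵀ * B * O).map Complex.ofReal := by
      have h4 : P' - P'ᵀ = (2 * Complex.I) • B.map Complex.ofReal := by
        ext i j
        have := congrFun₂ hP'pd.isHermitian j i
        rw [conjTranspose_apply] at this
        show P' i j - P' j i = 2 * Complex.I * ((P' i j).im : ℂ)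
        rw [← this]
        apply Complex.ext <;> simp
        ring
      have h5 : (Oᵀ * B * O).map Complex.ofReal = Ocᵀ * B.map Complex.ofReal * Oc := by
        rw [hOc, ← transpose_map]
        rw [← map_ofReal_mul, ← map_ofReal_mul]
      have h6 : X - Xᵀ = Ocᵀ * (P' - P'ᵀ) * Oc := by
        rw [hX, transpose_mul, transpose_mul, transpose_transpose, mul_sub, sub_mul]
        simp only [mul_assoc]
      rw [h6, h5, h4]
      simp
    have h6 : ∀ i j, (X - Xᵀ) (Sum.inl i) (Sum.inl j) = 0 := by
      intro i j; rw [h3]; simp [hOl]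
    have h7 : ∀ i j, (X - Xᵀ) (Sum.inr i) (Sum.inr j) = 0 := by
      intro i j; rw [h3]; simp [hOr]
    rw [← sub_mul, ← mul_sub, ← neg_sub X]
    ext i j
    rw [JC, mul_diagonal, diagonal_mul]
    rcases i with i | i <;> rcases j with j | j <;>
      simp only [h6, h7, Matrix.neg_apply, Sum.elim_inl, Sum.elim_inr] <;> ring
  have hXY : X = JC p q * Xᵀ * JC p q := by
    have hJconj : ∀ {M : Matrix (Fin p ⊕ Fin q) (Fin p ⊕ Fin q) ℂ}, M.PosDef →
        (JC p q * M * JC p q).PosDef := by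
      intro M hM
      have h := hM.conjTranspose_mul_mul_same (B := JC p q) (Matrix.mulVec_injective_of_isUnit
        (IsUnit.of_mul_eq_one _ (JC_mul_JC p q)))
      rwa [JC_conjTranspose] at h
    rw [← sub_eq_zero]
    refine (hXpd.isHermitian.sub (hJconj hXpd.transpose).isHermitian).eq_zero_of_mul_add_mul_eq_zero
      hXpd (hJconj hXpd) ?_
    have h3 := congrArg (fun M => X * M) hanti
    simp only [mul_sub, hXT'] at h3
    have h4 : (JC p q * Xᵀ * JC p q) * (JC p q * X * JC p q) = 1 := by
      calc (JC p q * Xᵀ * JC p q) * (JC p q * X * JC p q)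
          = JC p q * (Xᵀ * (JC p q * JC p q) * X) * JC p q := by simp only [mul_assoc]
        _ = 1 := by rw [JC_mul_JC, mul_one, hXT, mul_one, JC_mul_JC]
    rw [mul_sub, sub_mul, h4]
    rw [← sub_eq_zero] at h3
    rw [← h3]
    abel
  set k := ofRotation O hO hOd with hk
  have hkK : k ∈ unitaries p q := ofRotation_mem_unitaries O hO hOd
  set Q := Dᴴ * X * D with hQ
  have hQk : Q = (mat (g * k))ᴴ * mat (g * k) := by
    rw [mat_mul, hk, mat_ofRotation, hQ, hX, hP', hP, ← hOcT, ← hOc, ← hD]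
    simp only [conjTranspose_mul, conjTranspose_conjTranspose, mul_assoc]
  have hQpd : Q.PosDef := hQk ▸ posDef_conjTranspose_mul_mat (g * k)
  have hQT : Qᵀ = D * Xᵀ * Dᴴ := by
    rw [hQ, transpose_mul, transpose_mul, hD, sqrtJC_transpose, sqrtJC_conjTranspose_transpose,
      mul_assoc]
  have hQs : Qᵀ = Q := by
    rw [hQT, hQ]
    conv_rhs => rw [hXY]
    rw [← mul_assoc, ← mul_assoc, hD, conjTranspose_sqrtJC_mul_JC, mul_assoc _ (JC p q),
      JC_mul_sqrtJC]
  have hQJ : Q * JC p q * Q = JC p q := by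
    calc Q * JC p q * Q = Qᵀ * JC p q * Q := by rw [hQs]
      _ = D * Xᵀ * Dᴴ * JC p q * (Dᴴ * X * D) := by rw [hQT]
      _ = D * (Xᵀ * ((Dᴴ * JC p q) * Dᴴ) * X) * D := by simp only [mul_assoc]
      _ = JC p q := by
        rw [hD, conjTranspose_sqrtJC_mul_JC, sqrtJC_mul_conjTranspose, mul_one, hXT, mul_one,
          sqrtJC_mul_self]
  have hQd : Q.det = 1 := by
    rw [hQk, det_mul, det_conjTranspose, det_mat]
    simp
  obtain ⟨η, hη, hηQ⟩ := exists_realForm_mul_self_eq hQpd hQs hQJ hQd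
  refine ⟨g * k * η⁻¹, ?_, η, hη, k⁻¹, (unitaries p q).inv_mem hkK, by group⟩
  rw [mem_unitaries_iff, mat_mul, conjTranspose_mul, mul_assoc, ← mul_assoc (mat (g * k))ᴴ, ← hQk,
    ← hηQ]
  calc (mat η⁻¹)ᴴ * ((mat η)ᴴ * mat η * mat η⁻¹)
      = (mat η * mat η⁻¹)ᴴ * (mat η * mat η⁻¹) := by
        rw [conjTranspose_mul]
        simp only [mul_assoc]
    _ = 1 := by rw [mat_mul_inv]; simp

end SOC

end

section

open scoped Pointwise

namespace SOC

/-- The exponential of `t • N` for a matrix `N` with `N ^ 3 = N`. -/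
def boostMatrix {ι : Type*} [Fintype ι] [DecidableEq ι] (N : Matrix ι ι ℂ) (t : ℝ) :
    Matrix ι ι ℂ :=
  1 + ((Real.cosh t - 1 : ℝ) : ℂ) • (N * N) + (Real.sinh t : ℂ) • N

theorem boostMatrix_zero {ι : Type*} [Fintype ι] [DecidableEq ι] (N : Matrix ι ι ℂ) :
    boostMatrix N 0 = 1 := by
  simp [boostMatrix]

theorem boostMatrix_mul {ι : Type*} [Fintype ι] [DecidableEq ι] {N : Matrix ι ι ℂ}
    (hN : N * N * N = N) (s t : ℝ) :
    boostMatrix N s * boostMatrix N t = boostMatrix N (s + t) := by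
  have h1 : N * (N * N) = N := by rw [← mul_assoc, hN]
  have h2 : N * N * (N * N) = N * N := by rw [← mul_assoc, hN]
  simp only [boostMatrix, add_mul, mul_add, one_mul, mul_one, smul_mul_smul_comm, h1, h2, hN,
    Real.cosh_add, Real.sinh_add]
  match_scalars <;> ring

variable {p q : ℕ} {N : Matrix (Fin p ⊕ Fin q) (Fin p ⊕ Fin q) ℂ}

theorem boostMatrix_transpose_mul (hN : N * N * N = N) (hNJ : Nᵀ * JC p q = -(JC p q * N)) (t : ℝ) :
    (boostMatrix N t)ᵀ * JC p q * boostMatrix N t = JC p q := by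
  have h1 : Nᵀ * Nᵀ * JC p q = JC p q * (N * N) := by
    rw [mul_assoc, hNJ, mul_neg, ← mul_assoc, hNJ, neg_mul, neg_neg, mul_assoc]
  have h2 : (boostMatrix N t)ᵀ * JC p q = JC p q * boostMatrix N (-t) := by
    simp only [boostMatrix, transpose_add, transpose_smul, transpose_one, transpose_mul, add_mul,
      mul_add, smul_mul_assoc, h1, hNJ, Real.cosh_neg, Real.sinh_neg, mul_smul_comm, one_mul,
      mul_one]
    simp
  rw [h2, mul_assoc, boostMatrix_mul hN, neg_add_cancel, boostMatrix_zero, mul_one]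

theorem det_boostMatrix (hN : N * N * N = N) (hNJ : Nᵀ * JC p q = -(JC p q * N)) (t : ℝ) :
    (boostMatrix N t).det = 1 := by
  have h1 := congrArg det (boostMatrix_transpose_mul hN hNJ (t / 2))
  have h2 : (JC p q).det * (JC p q).det = 1 := by rw [← det_mul, JC_mul_JC, det_one]
  have h3 : (JC p q).det ≠ 0 := left_ne_zero_of_mul_eq_one h2
  rw [det_mul, det_mul, det_transpose] at h1
  have h4 : (boostMatrix N (t / 2)).det * (boostMatrix N (t / 2)).det = 1 := by
    apply mul_right_cancel₀ h3
    linear_combination h1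
  rw [← h4, ← det_mul, boostMatrix_mul hN, add_halves]

/-- The one-parameter group generated by `N`. -/
def boost (hN : N * N * N = N) (hNJ : Nᵀ * JC p q = -(JC p q * N)) (t : ℝ) : SOC p q :=
  ofMatrix (boostMatrix N t) (boostMatrix_transpose_mul hN hNJ t) (det_boostMatrix hN hNJ t)

theorem mat_boost (hN : N * N * N = N) (hNJ : Nᵀ * JC p q = -(JC p q * N)) (t : ℝ) :
    mat (boost hN hNJ t) = boostMatrix N t := rfl

theorem mat_mul_mul_conjTranspose_of_mem {η : SOC p q} (hη : η ∈ SOCrealForm p q) (g : SOC p q) :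
    mat (g * η) * JC p q * (mat (g * η))ᴴ = mat g * JC p q * (mat g)ᴴ := by
  rw [mat_mul, conjTranspose_mul, conjTranspose_eq_transpose_of_mem hη]
  calc mat g * mat η * JC p q * ((mat η)ᵀ * (mat g)ᴴ)
      = mat g * (mat η * JC p q * (mat η)ᵀ) * (mat g)ᴴ := by simp only [mul_assoc]
    _ = _ := by rw [mat_mul_transpose]

theorem exists_lt_cosh (R : ℝ) : ∃ t, R < Real.cosh t := by
  refine ⟨2 * R, ?_⟩
  have h1 := Real.cosh_eq (2 * R)
  have h2 := Real.add_one_le_exp (2 * R)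
  have h3 := Real.exp_pos (-(2 * R))
  linarith

theorem mulVec_ofReal_of_mem {η : SOC p q} (hη : η ∈ SOCrealForm p q) (x : Fin p ⊕ Fin q → ℝ) :
    mat η *ᵥ (fun i => (x i : ℂ)) = fun i => ((((mat η).map Complex.re) *ᵥ x) i : ℂ) := by
  ext i
  have h := fun j => (mem_realForm_iff η).1 hη i j
  simp only [mulVec, dotProduct, map_apply, Complex.ofReal_sum, Complex.ofReal_mul]
  refine Finset.sum_congr rfl fun j _ => ?_
  congr 1
  apply Complex.ext <;> simp [h]

theorem not_cocompact_of_hermitian_boost (hp : 0 < p) (Γ : Subgroup (SOC p q))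
    [ProperlyDiscontinuousSMul ↥Γ (SOC p q ⧸ SOCrealForm p q)]
    (hN : N * N * N = N) (hNJ : Nᵀ * JC p q = -(JC p q * N)) (hNH : Nᴴ = N)
    (hJN : JC p q * N = N * JC p q) (a : Fin p ⊕ Fin q) (hNa : N a a = 0) (hNNa : (N * N) a a = 1)
    {m : ℕ} (hmp : m ≤ p) (hmq : m ≤ q) (π : (Fin p ⊕ Fin q → ℝ) →ₗ[ℝ] (Fin m → ℝ))
    (hNπ : ∀ x, π x = 0 → N *ᵥ (fun i => (x i : ℂ)) = 0) {d : ℂ} (hd0 : d ≠ 0)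
    (hd : ∀ x, π x = 0 → sqrtJC p q *ᵥ (fun i => (x i : ℂ)) = d • fun i => (x i : ℂ)) :
    ¬ CompactSpace (MulAction.orbitRel.Quotient ↥Γ (SOC p q ⧸ SOCrealForm p q)) := by
  intro hcpt
  obtain ⟨C, hC, hCG⟩ := exists_isCompact_forall_eq_mul_mul Γ (SOCrealForm p q)
  have hfin := ProperlyDiscontinuousSMul.finite_setOf_mul_eq_mul Γ (SOCrealForm p q)
    (hC.mul (isCompact_unitaries (p := p) (q := q))) (isCompact_unitaries (p := p) (q := q))
  set Φ := {γ : SOC p q | γ ∈ Γ ∧ ∃ a ∈ C * (unitaries p q : Set (SOC p q)),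
    ∃ b ∈ (unitaries p q : Set (SOC p q)), ∃ η ∈ SOCrealForm p q, γ * a = b * η}
  have hJd : ∀ x, π x = 0 → JC p q *ᵥ (fun i => (x i : ℂ)) = (d * d) • fun i => (x i : ℂ) := by
    intro x hx
    rw [← sqrtJC_mul_self, ← mulVec_mulVec, hd x hx, mulVec_smul, hd x hx, smul_smul]
  have hfix : ∀ t x, π x = 0 → boostMatrix N t *ᵥ (fun i => (x i : ℂ)) = fun i => (x i : ℂ) := by
    intro t x hx
    simp [boostMatrix, add_mulVec, smul_mulVec, ← mulVec_mulVec, hNπ x hx]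
  have hherm : ∀ t, (boostMatrix N t)ᴴ = boostMatrix N t := by
    intro t
    simp only [boostMatrix, conjTranspose_add, conjTranspose_smul, conjTranspose_mul, hNH,
      conjTranspose_one, Complex.star_def, Complex.conj_ofReal]
  have hmem : ∀ t, ∃ γ ∈ Φ, ∃ c ∈ C, ∃ η ∈ SOCrealForm p q, boost hN hNJ t = γ * c * η := by
    intro t
    obtain ⟨γ, hγ, c, hc, η, hη, h⟩ := hCG (boost hN hNJ t)
    refine ⟨γ, ⟨hγ, ?_⟩, c, hc, η, hη, h⟩
    set ζ := η⁻¹ with hζ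
    have hζH : ζ ∈ SOCrealForm p q := (SOCrealForm p q).inv_mem hη
    let ψ := π.prod (π ∘ₗ ((mat ζ).map Complex.re).mulVecLin)
    have hdim : p + q ≤ 2 * m + Module.finrank ℝ (LinearMap.ker ψ) := by
      have h1 := ψ.finrank_range_add_finrank_ker
      have h2 := (LinearMap.range ψ).finrank_le
      simp only [Module.finrank_prod, Module.finrank_pi, Fintype.card_sum,
        Fintype.card_fin] at h1 h2
      omega
    obtain ⟨k₁, hk₁, η', hη', k₂, hk₂, hk⟩ := exists_mul_mul_eq_of_fixed hp (boost hN hNJ t * ζ)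
      (LinearMap.ker ψ) (by
        intro x hx
        have hx1 : π x = 0 := congrArg Prod.fst hx
        have hx2 : π (((mat ζ).map Complex.re) *ᵥ x) = 0 := congrArg Prod.snd hx
        rw [mat_mul, conjTranspose_mul, ← mulVec_mulVec, ← mulVec_mulVec, ← mulVec_mulVec,
          mulVec_ofReal_of_mem hζH, mat_boost, hfix t _ hx2, hherm, hfix t _ hx2]
        have h3 := hJd _ hx2
        rw [← mulVec_ofReal_of_mem hζH] at h3 ⊢
        have h4 := congrArg (fun v => (mat ζ)ᵀ *ᵥ v) h3
        simp only [mulVec_mulVec, mulVec_smul] at h4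
        rw [← mul_assoc, mat_transpose_mul, hJd x hx1] at h4
        rw [conjTranspose_eq_transpose_of_mem hζH, mulVec_mulVec]
        exact (smul_right_injective _ (mul_ne_zero hd0 hd0) h4).symm)
      hd0 (fun x hx => hd x (congrArg Prod.fst hx)) (by omega) (by omega)
    refine ⟨c * k₂⁻¹, Set.mul_mem_mul hc ((unitaries p q).inv_mem hk₂), k₁, hk₁, η', hη', ?_⟩
    have h5 : γ * c = k₁ * η' * k₂ := by rw [← hk, h, hζ]; group
    rw [← mul_assoc, h5]; group
  have hcont : Continuous fun g : SOC p q => (mat g * JC p q * (mat g)ᴴ) a a :=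
    ((continuous_mat.matrix_mul continuous_const).matrix_mul
      continuous_mat.matrix_conjTranspose).matrix_elem a a
  obtain ⟨R, hR⟩ := ((hfin.isCompact.mul hC).image hcont).isBounded.exists_norm_le
  obtain ⟨t, ht⟩ := exists_lt_cosh R
  obtain ⟨γ, hγ, c, hc, η, hη, h⟩ := hmem (t / 2)
  have h1 := hR _ ⟨γ * c, Set.mul_mem_mul hγ hc, rfl⟩
  have h2 := mat_mul_mul_conjTranspose_of_mem hη (γ * c)
  have hcomm : JC p q * boostMatrix N (t / 2) = boostMatrix N (t / 2) * JC p q := by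
    simp only [boostMatrix, mul_add, add_mul, mul_one, one_mul, mul_smul_comm, smul_mul_assoc, hJN]
    rw [← mul_assoc, hJN, mul_assoc, hJN, ← mul_assoc]
  rw [← h, mat_boost, hherm, ← hcomm, mul_assoc, boostMatrix_mul hN, add_halves] at h2
  simp only [← h2] at h1
  rw [JC, diagonal_mul, norm_mul] at h1
  have h3 : boostMatrix N t a a = (Real.cosh t : ℂ) := by
    simp [boostMatrix, hNa, hNNa]
  have h4 : ‖(Sum.elim (fun _ => 1) (fun _ => -1) : Fin p ⊕ Fin q → ℂ) a‖ = 1 := by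
    rcases a with a | a <;> simp
  rw [h3, h4, one_mul, Complex.norm_real] at h1
  exact absurd ((le_abs_self _).trans h1) (not_le.2 ht)

theorem single_sub_single_mul_self {ι : Type*} [Fintype ι] [DecidableEq ι] {a b : ι} (hab : a ≠ b) :
    Complex.I • (Matrix.single a b (1 : ℂ) - Matrix.single b a 1) *
      Complex.I • (Matrix.single a b (1 : ℂ) - Matrix.single b a 1) =
      Matrix.single a a 1 + Matrix.single b b 1 := by
  rw [smul_mul_smul_comm, Complex.I_mul_I, sub_mul, mul_sub, mul_sub, single_mul_single_same,
    single_mul_single_same, single_mul_single_of_ne _ _ _ _ hab.symm,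
    single_mul_single_of_ne _ _ _ _ hab]
  simp [add_comm]

theorem not_cocompact_of_one_lt (hp : 1 < p) (hq : 1 < q) (Γ : Subgroup (SOC p q))
    [ProperlyDiscontinuousSMul ↥Γ (SOC p q ⧸ SOCrealForm p q)] :
    ¬ CompactSpace (MulAction.orbitRel.Quotient ↥Γ (SOC p q ⧸ SOCrealForm p q)) := by
  have key : ∀ (a b : Fin p ⊕ Fin q) (hab : a ≠ b)
      (hJ : (Sum.elim (fun _ => 1) (fun _ => -1) : Fin p ⊕ Fin q → ℂ) a =
        (Sum.elim (fun _ => 1) (fun _ => -1) : Fin p ⊕ Fin q → ℂ) b)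
      {m : ℕ} (hmp : m ≤ p) (hmq : m ≤ q) (π : (Fin p ⊕ Fin q → ℝ) →ₗ[ℝ] (Fin m → ℝ))
      (hπ : ∀ x, π x = 0 → x a = 0 ∧ x b = 0) {d : ℂ} (hd0 : d ≠ 0)
      (hd : ∀ x, π x = 0 → sqrtJC p q *ᵥ (fun i => (x i : ℂ)) = d • fun i => (x i : ℂ)),
      ¬ CompactSpace (MulAction.orbitRel.Quotient ↥Γ (SOC p q ⧸ SOCrealForm p q)) := by
    intro a b hab hJ m hmp hmq π hπ d hd0 hd
    set N : Matrix (Fin p ⊕ Fin q) (Fin p ⊕ Fin q) ℂ :=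
      Complex.I • (Matrix.single a b (1 : ℂ) - Matrix.single b a 1) with hNdef
    have hNN : N * N = Matrix.single a a 1 + Matrix.single b b 1 := single_sub_single_mul_self hab
    have hJN : JC p q * N = N * JC p q := by
      ext i j
      rw [JC, diagonal_mul, mul_diagonal]
      simp only [hNdef, Matrix.smul_apply, Matrix.sub_apply, single_apply, smul_eq_mul]
      split_ifs with h1 h2 h2
      · simp
      · obtain ⟨rfl, rfl⟩ := h1; rw [hJ]; ring
      · obtain ⟨rfl, rfl⟩ := h2; rw [hJ]; ring
      · simp
    have hNT : Nᵀ = -N := by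
      simp [hNdef, ← smul_neg]
    refine not_cocompact_of_hermitian_boost (N := N) (by omega) Γ ?_ ?_ ?_ hJN a ?_ ?_ hmp hmq π
      ?_ hd0 hd
    · rw [hNN]
      rw [hNdef, mul_smul_comm, add_mul, mul_sub, mul_sub, single_mul_single_same,
        single_mul_single_same, single_mul_single_of_ne _ _ _ _ hab.symm,
        single_mul_single_of_ne _ _ _ _ hab]
      simp [sub_eq_add_neg]
    · rw [hNT, neg_mul, hJN]
    · simp [hNdef, ← smul_neg]
    · simp [hNdef, hab.symm]
    · rw [hNN]; simp [hab.symm]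
    · intro x hx
      obtain ⟨h1, h2⟩ := hπ x hx
      rw [hNdef, smul_mulVec, sub_mulVec]
      ext i
      simp [single_mulVec, h1, h2]
  rcases le_total p q with h | h
  · refine key (Sum.inl ⟨0, by omega⟩) (Sum.inl ⟨1, by omega⟩) (by simp) rfl le_rfl h
      (LinearMap.funLeft ℝ ℝ Sum.inl) (fun x hx => ⟨congrFun hx _, congrFun hx _⟩)
      Complex.I_ne_zero ?_
    intro x hx
    ext i
    rw [sqrtJC, mulVec_diagonal]
    rcases i with i | i
    · have : x (Sum.inl i) = 0 := congrFun hx i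
      simp [this]
    · simp
  · refine key (Sum.inr ⟨0, by omega⟩) (Sum.inr ⟨1, by omega⟩) (by simp) rfl h le_rfl
      (LinearMap.funLeft ℝ ℝ Sum.inr) (fun x hx => ⟨congrFun hx _, congrFun hx _⟩) one_ne_zero ?_
    intro x hx
    ext i
    rw [sqrtJC, mulVec_diagonal]
    rcases i with i | i
    · simp
    · have : x (Sum.inr i) = 0 := congrFun hx i
      simp [this]

end SOC

end

section

open scoped Pointwise

theorem map_re_ofReal_mul {ι : Type*} [Fintype ι] (A : Matrix ι ι ℝ) (X : Matrix ι ι ℂ) :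
    (A.map Complex.ofReal * X).map Complex.re = A * X.map Complex.re := by
  ext i j
  simp [mul_apply]

theorem map_re_mul_ofReal {ι : Type*} [Fintype ι] (A : Matrix ι ι ℝ) (X : Matrix ι ι ℂ) :
    (X * A.map Complex.ofReal).map Complex.re = X.map Complex.re * A := by
  ext i j
  simp [mul_apply]

theorem map_im_ofReal_mul {ι : Type*} [Fintype ι] (A : Matrix ι ι ℝ) (X : Matrix ι ι ℂ) :
    (A.map Complex.ofReal * X).map Complex.im = A * X.map Complex.im := by
  ext i j
  simp [mul_apply]

theorem map_im_mul_ofReal {ι : Type*} [Fintype ι] (A : Matrix ι ι ℝ) (X : Matrix ι ι ℂ) :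
    (X * A.map Complex.ofReal).map Complex.im = X.map Complex.im * A := by
  ext i j
  simp [mul_apply]

namespace SOC

variable {p q : ℕ}

/-- The real part of the Gram matrix of `g`. -/
def gram (g : SOC p q) : Matrix (Fin p ⊕ Fin q) (Fin p ⊕ Fin q) ℝ :=
  ((mat g)ᴴ * mat g).map Complex.re

theorem continuous_gram : Continuous (gram : SOC p q → _) :=
  (continuous_mat.matrix_conjTranspose.matrix_mul continuous_mat).matrix_map Complex.continuous_re

theorem map_re_map_ofReal_of_mem {η : SOC p q} (hη : η ∈ SOCrealForm p q) :
    ((mat η).map Complex.re).map Complex.ofReal = mat η := by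
  ext i j
  exact Complex.ext rfl ((mem_realForm_iff η).1 hη i j).symm

theorem gram_mul_of_mem {η : SOC p q} (hη : η ∈ SOCrealForm p q) (g : SOC p q) :
    gram (g * η) = ((mat η).map Complex.re)ᵀ * gram g * (mat η).map Complex.re := by
  rw [gram, gram, ← map_re_ofReal_mul _ ((mat g)ᴴ * mat g), ← map_re_mul_ofReal,
    map_re_map_ofReal_of_mem hη,
    transpose_map, map_re_map_ofReal_of_mem hη, mat_mul, conjTranspose_mul,
    conjTranspose_eq_transpose_of_mem hη]
  simp only [mul_assoc]

theorem dotProduct_gram_mulVec (g : SOC p q) (x : Fin p ⊕ Fin q → ℝ) :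
    x ⬝ᵥ (gram g *ᵥ x) = ∑ k, ‖(mat g *ᵥ fun i => (x i : ℂ)) k‖ ^ 2 := by
  have h1 : ((x ⬝ᵥ (gram g *ᵥ x) : ℝ)) =
      ((fun i => (x i : ℂ)) ⬝ᵥ (((mat g)ᴴ * mat g) *ᵥ fun i => (x i : ℂ))).re := by
    simp [dotProduct, mulVec, gram]
  have h2 : star (mat g *ᵥ fun i => (x i : ℂ)) = (fun i => (x i : ℂ)) ᵥ* (mat g)ᴴ := by
    rw [star_mulVec]
    congr 1
    ext i
    simp
  rw [h1, ← mulVec_mulVec, dotProduct_mulVec, ← h2, dotProduct, Complex.re_sum]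
  refine Finset.sum_congr rfl fun k _ => ?_
  rw [Pi.star_apply, Complex.star_def, ← Complex.normSq_eq_conj_mul_self, Complex.ofReal_re,
    Complex.normSq_eq_norm_sq]

theorem exists_pos_mul_dotProduct_le {C : Set (SOC p q)} (hC : IsCompact C) :
    ∃ α : ℝ, 0 < α ∧ ∀ c ∈ C, ∀ x : Fin p ⊕ Fin q → ℝ, α * (x ⬝ᵥ x) ≤ x ⬝ᵥ (gram c *ᵥ x) := by
  obtain ⟨R, hR0, hR⟩ := exists_bound_of_isCompact hC.inv
  set n : ℝ := ((Fintype.card (Fin p ⊕ Fin q) : ℕ) : ℝ) with hn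
  have hn0 : 0 ≤ n := Nat.cast_nonneg _
  have hpos : 0 < n * (n * R ^ 2) + 1 := by positivity
  refine ⟨(n * (n * R ^ 2) + 1)⁻¹, inv_pos.2 hpos, fun c hc x => ?_⟩
  rw [inv_mul_le_iff₀ hpos, dotProduct_gram_mulVec]
  set v := mat c *ᵥ fun i => (x i : ℂ) with hv
  set S := ∑ k, ‖v k‖ ^ 2
  have hS0 : 0 ≤ S := by positivity
  have hx : (fun i => (x i : ℂ)) = mat c⁻¹ *ᵥ v := by
    rw [hv, mulVec_mulVec, mat_inv_mul, one_mulVec]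
  have hxi : ∀ i, x i * x i ≤ n * R ^ 2 * S := by
    intro i
    have h1 : |x i| ≤ ∑ k, ‖mat c⁻¹ i k‖ * ‖v k‖ := by
      have h2 : (x i : ℂ) = ∑ k, mat c⁻¹ i k * v k := congrFun hx i
      have h3 : |x i| = ‖(x i : ℂ)‖ := (Complex.norm_real _).symm
      rw [h3, h2]
      refine (norm_sum_le _ _).trans (le_of_eq ?_)
      simp
    calc x i * x i = |x i| ^ 2 := by rw [sq_abs]; ring
      _ ≤ (∑ k, ‖mat c⁻¹ i k‖ * ‖v k‖) ^ 2 := by gcongr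
      _ ≤ (∑ k, ‖mat c⁻¹ i k‖ ^ 2) * S := Finset.sum_mul_sq_le_sq_mul_sq _ _ _
      _ ≤ (∑ _k : Fin p ⊕ Fin q, R ^ 2) * S := by
          gcongr with k
          exact hR _ (Set.inv_mem_inv.2 hc) i k
      _ = n * R ^ 2 * S := by simp [hn]
  calc x ⬝ᵥ x ≤ ∑ _i : Fin p ⊕ Fin q, n * R ^ 2 * S := Finset.sum_le_sum fun i _ => hxi i
    _ = n * (n * R ^ 2) * S := by simp [hn, mul_assoc]
    _ ≤ (n * (n * R ^ 2) + 1) * S := by gcongr; linarith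

section Average

variable (Γ : Subgroup (SOC p q)) (χ : SOC p q ⧸ SOCrealForm p q → ℝ)

/-- The weighted sum of the Gram matrices along a `Γ`-orbit. -/
def average (g : SOC p q) : Matrix (Fin p ⊕ Fin q) (Fin p ⊕ Fin q) ℝ :=
  ∑ᶠ γ : ↥Γ, χ (((γ : SOC p q) * g : SOC p q)) • gram ((γ : SOC p q) * g)

theorem average_mul_left {γ : SOC p q} (hγ : γ ∈ Γ) (g : SOC p q) :
    average Γ χ (γ * g) = average Γ χ g := by
  rw [average, average, ← finsum_comp_equiv (Equiv.mulRight (⟨γ, hγ⟩ : ↥Γ))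
    (f := fun δ : ↥Γ => χ (((δ : SOC p q) * g : SOC p q)) • gram ((δ : SOC p q) * g))]
  simp [mul_assoc]

variable [ProperlyDiscontinuousSMul ↥Γ (SOC p q ⧸ SOCrealForm p q)] {χ}

theorem exists_finset_average_eq_sum (hχ : HasCompactSupport χ) {A : Set (SOC p q)}
    (hA : IsCompact A) : ∃ Φ : Finset ↥Γ, 1 ∈ Φ ∧ ∀ a ∈ A, average Γ χ a =
      ∑ γ ∈ Φ, χ (((γ : SOC p q) * a : SOC p q)) • gram ((γ : SOC p q) * a) := by
  classical
  have h := ProperlyDiscontinuousSMul.finite_disjoint_inter_image (Γ := ↥Γ)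
    (hA.image (QuotientGroup.continuous_mk (N := SOCrealForm p q))) hχ.isCompact
  refine ⟨insert 1 h.toFinset, Finset.mem_insert_self _ _, fun a ha => ?_⟩
  refine finsum_eq_sum_of_support_subset _ fun γ hγ => ?_
  rw [Finset.coe_insert, Set.Finite.coe_toFinset]
  refine Set.mem_insert_of_mem _ ?_
  have h1 : χ (((γ : SOC p q) * a : SOC p q)) ≠ 0 := left_ne_zero_of_smul hγ
  exact ⟨(((γ : SOC p q) * a : SOC p q)), ⟨(a : SOC p q ⧸ SOCrealForm p q), ⟨a, ha, rfl⟩, rfl⟩,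
      subset_tsupport _ h1⟩

theorem average_mul_of_mem (hχ : HasCompactSupport χ) {η : SOC p q} (hη : η ∈ SOCrealForm p q)
    (g : SOC p q) : average Γ χ (g * η) =
      ((mat η).map Complex.re)ᵀ * average Γ χ g * (mat η).map Complex.re := by
  obtain ⟨Φ, -, hΦ⟩ := exists_finset_average_eq_sum Γ hχ (Set.toFinite {g, g * η}).isCompact
  rw [hΦ g (by simp), hΦ (g * η) (by simp), Finset.mul_sum, Finset.sum_mul]
  refine Finset.sum_congr rfl fun γ _ => ?_
  rw [← mul_assoc, gram_mul_of_mem hη, QuotientGroup.mk_mul_of_mem _ hη, mul_smul_comm,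
    smul_mul_assoc]

theorem exists_average_bounds (hχ : HasCompactSupport χ) (hχc : Continuous χ) (hχ0 : ∀ x, 0 ≤ χ x)
    {C : Set (SOC p q)} (hC : IsCompact C) (hχC : ∀ c ∈ C, χ (c : SOC p q) = 1) :
    ∃ α β : ℝ, 0 < α ∧ 0 ≤ β ∧ ∀ c ∈ C, (∀ i j, |average Γ χ c i j| ≤ β) ∧
      ∀ x : Fin p ⊕ Fin q → ℝ, α * (x ⬝ᵥ x) ≤ x ⬝ᵥ (average Γ χ c *ᵥ x) := by
  obtain ⟨Φ, h1Φ, hΦ⟩ := exists_finset_average_eq_sum Γ hχ hC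
  obtain ⟨α, hα, hαC⟩ := exists_pos_mul_dotProduct_le hC
  have hcont : Continuous fun c : SOC p q =>
      ∑ γ ∈ Φ, χ (((γ : SOC p q) * c : SOC p q)) • gram ((γ : SOC p q) * c) := by
    refine continuous_finsetSum _ fun γ _ => ?_
    exact (hχc.comp (QuotientGroup.continuous_mk.comp (continuous_const_mul _))).smul
      (continuous_gram.comp (continuous_const_mul _))
  obtain ⟨β, hβ⟩ := hC.exists_bound_of_continuousOn (f := fun c => ∑ i, ∑ j, |(∑ γ ∈ Φ,
    χ (((γ : SOC p q) * c : SOC p q)) • gram ((γ : SOC p q) * c)) i j|)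
    (continuous_finsetSum _ fun i _ => continuous_finsetSum _ fun j _ =>
      (hcont.matrix_elem i j).abs).continuousOn
  refine ⟨α, max β 0, hα, le_max_right _ _, fun c hc => ⟨fun i j => ?_, fun x => ?_⟩⟩
  · rw [hΦ c hc]
    refine le_max_of_le_left (le_trans ?_ ((le_abs_self _).trans (hβ c hc)))
    refine le_trans ?_ (Finset.single_le_sum (f := fun i => ∑ j, |(∑ γ ∈ Φ,
      χ (((γ : SOC p q) * c : SOC p q)) • gram ((γ : SOC p q) * c)) i j|)
      (fun _ _ => Finset.sum_nonneg fun _ _ => abs_nonneg _) (Finset.mem_univ i))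
    exact Finset.single_le_sum (f := fun j => |(∑ γ ∈ Φ,
      χ (((γ : SOC p q) * c : SOC p q)) • gram ((γ : SOC p q) * c)) i j|)
      (fun _ _ => abs_nonneg _) (Finset.mem_univ j)
  · rw [hΦ c hc, sum_mulVec, dotProduct_sum]
    refine (hαC c hc x).trans ?_
    have h2 := Finset.single_le_sum (f := fun γ : ↥Γ =>
      x ⬝ᵥ ((χ (((γ : SOC p q) * c : SOC p q)) • gram ((γ : SOC p q) * c)) *ᵥ x)) (s := Φ)
      (fun γ _ => by
        rw [smul_mulVec, dotProduct_smul, dotProduct_gram_mulVec, smul_eq_mul]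
        exact mul_nonneg (hχ0 _) (by positivity)) h1Φ
    simpa [hχC c hc] using h2

end Average
end SOC

end

/-- The half turn about the line spanned by `a`. -/
def halfTurn {ι : Type*} [Fintype ι] [DecidableEq ι] (a : ι → ℝ) : Matrix ι ι ℝ :=
  (2 / (a ⬝ᵥ a)) • vecMulVec a a - 1

section HalfTurn

variable {ι : Type*} [Fintype ι] [DecidableEq ι]

theorem halfTurn_transpose (a : ι → ℝ) : (halfTurn a)ᵀ = halfTurn a := by
  simp [halfTurn, transpose_vecMulVec]

theorem halfTurn_mul_self {a : ι → ℝ} (ha : a ≠ 0) : halfTurn a * halfTurn a = 1 := by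
  have h : a ⬝ᵥ a ≠ 0 := dotProduct_self_eq_zero.not.2 ha
  have h1 : vecMulVec a a * vecMulVec a a = (a ⬝ᵥ a) • vecMulVec a a := by
    rw [vecMulVec_mul_vecMulVec, vecMulVec_smul]
  rw [halfTurn, sub_mul, mul_sub, smul_mul_smul_comm, h1, smul_smul, one_mul, mul_one,
    show 2 / (a ⬝ᵥ a) * (2 / (a ⬝ᵥ a)) * (a ⬝ᵥ a) = 2 / (a ⬝ᵥ a) + 2 / (a ⬝ᵥ a) by field_simp; ring,
    add_smul]
  abel

theorem det_halfTurn (hι : Odd (Fintype.card ι)) {a : ι → ℝ} (ha : a ≠ 0) :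
    (halfTurn a).det = 1 := by
  have h : a ⬝ᵥ a ≠ 0 := dotProduct_self_eq_zero.not.2 ha
  have h1 : halfTurn a = -(1 + vecMulVec (-(2 / (a ⬝ᵥ a)) • a) a) := by
    rw [halfTurn, smul_vecMulVec, neg_smul]
    abel
  rw [h1, det_neg, hι.neg_one_pow, vecMulVec_eq Unit, det_one_add_replicateCol_mul_replicateRow,
    dotProduct_smul, smul_eq_mul]
  field_simp
  norm_num

theorem halfTurn_mulVec (a x : ι → ℝ) :
    halfTurn a *ᵥ x = (2 * (a ⬝ᵥ x) / (a ⬝ᵥ a)) • a - x := by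
  rw [halfTurn, sub_mulVec, smul_mulVec, one_mulVec, vecMulVec_mulVec, op_smul_eq_smul, smul_smul]
  congr 2
  ring

theorem halfTurn_mulVec_of_dotProduct_eq {u v : ι → ℝ} (h : u ⬝ᵥ u = v ⬝ᵥ v) (huv : u + v ≠ 0) :
    halfTurn (u + v) *ᵥ v = u := by
  have h0 : (u + v) ⬝ᵥ (u + v) ≠ 0 := dotProduct_self_eq_zero.not.2 huv
  have h1 : 2 * ((u + v) ⬝ᵥ v) = (u + v) ⬝ᵥ (u + v) := by
    simp only [add_dotProduct, dotProduct_add, h, dotProduct_comm v u]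
    ring
  rw [halfTurn_mulVec, h1, div_self h0, one_smul, add_sub_cancel_right]

theorem continuousAt_halfTurn {a : ι → ℝ} (ha : a ≠ 0) : ContinuousAt halfTurn a := by
  have h : a ⬝ᵥ a ≠ 0 := dotProduct_self_eq_zero.not.2 ha
  have h1 : ContinuousAt (fun a : ι → ℝ => 2 / (a ⬝ᵥ a)) a :=
    continuousAt_const.div (Continuous.dotProduct continuous_id continuous_id).continuousAt h
  have h2 : ContinuousAt (fun a : ι → ℝ => vecMulVec a a) a :=
    (Continuous.matrix_vecMulVec continuous_id continuous_id).continuousAt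
  exact (h1.smul h2).sub continuousAt_const

end HalfTurn

namespace SOC

variable {q : ℕ}

theorem mat_inv_ofRotation {p : ℕ} (O : Matrix (Fin p ⊕ Fin q) (Fin p ⊕ Fin q) ℝ)
    (hO : Oᵀ * O = 1) (hd : O.det = 1) :
    mat (ofRotation O hO hd)⁻¹ = (sqrtJC p q)ᴴ * Oᵀ.map Complex.ofReal * sqrtJC p q := by
  rw [mat_inv, mat_ofRotation, transpose_mul, transpose_mul, sqrtJC_transpose,
    sqrtJC_conjTranspose_transpose, transpose_map]
  calc JC p q * (sqrtJC p q * ((O.map Complex.ofReal)ᵀ * (sqrtJC p q)ᴴ)) * JC p q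
      = (JC p q * sqrtJC p q) * (O.map Complex.ofReal)ᵀ * ((sqrtJC p q)ᴴ * JC p q) := by
        simp only [mul_assoc]
    _ = _ := by rw [JC_mul_sqrtJC, conjTranspose_sqrtJC_mul_JC]

theorem mk_ofRotation_eq {O O' : Matrix (Fin 1 ⊕ Fin q) (Fin 1 ⊕ Fin q) ℝ}
    (hO : Oᵀ * O = 1) (hd : O.det = 1) (hO' : O'ᵀ * O' = 1) (hd' : O'.det = 1) {ε : ℝ} (hε : ε ≠ 0)
    (h : O' *ᵥ Pi.single (Sum.inl 0) 1 = ε • (O *ᵥ Pi.single (Sum.inl 0) 1)) :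
    ((ofRotation O hO hd : SOC 1 q) : SOC 1 q ⧸ SOCrealForm 1 q) = ofRotation O' hO' hd' := by
  set e : Fin 1 ⊕ Fin q → ℝ := Pi.single (Sum.inl 0) 1 with he
  rw [QuotientGroup.eq, mem_realForm_iff, mat_mul, mat_inv_ofRotation, mat_ofRotation]
  have hOO : O * Oᵀ = 1 := mul_eq_one_comm.1 hO
  set Q := Oᵀ * O' with hQ
  have h1 : Q *ᵥ e = ε • e := by
    rw [hQ, ← mulVec_mulVec, h, mulVec_smul, mulVec_mulVec, hO, one_mulVec]
  have h2 : Qᵀ *ᵥ e = ε⁻¹ • e := by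
    have h3 : O *ᵥ e = ε⁻¹ • (O' *ᵥ e) := by rw [h, smul_smul, inv_mul_cancel₀ hε, one_smul]
    rw [hQ, transpose_mul, transpose_transpose, ← mulVec_mulVec, h3, mulVec_smul, mulVec_mulVec,
      hO', one_mulVec]
  have h1' : ∀ j, Q (Sum.inr j) (Sum.inl 0) = 0 := by
    intro j
    have := congrFun h1 (Sum.inr j)
    simpa [he, mulVec_single] using this
  have h2' : ∀ j, Q (Sum.inl 0) (Sum.inr j) = 0 := by
    intro j
    have := congrFun h2 (Sum.inr j)
    simpa [he, mulVec_single] using this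
  have h4 : (sqrtJC 1 q)ᴴ * Oᵀ.map Complex.ofReal * sqrtJC 1 q *
      ((sqrtJC 1 q)ᴴ * O'.map Complex.ofReal * sqrtJC 1 q) =
      (sqrtJC 1 q)ᴴ * Q.map Complex.ofReal * sqrtJC 1 q := by
    rw [hQ, map_ofReal_mul]
    calc _ = (sqrtJC 1 q)ᴴ * Oᵀ.map Complex.ofReal * (sqrtJC 1 q *
          (sqrtJC 1 q)ᴴ) * O'.map Complex.ofReal * sqrtJC 1 q := by simp only [mul_assoc]
      _ = _ := by rw [sqrtJC_mul_conjTranspose, mul_one]; simp only [mul_assoc]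
  rw [h4, sqrtJC, diagonal_conjTranspose]
  intro i j
  rw [mul_diagonal, diagonal_mul]
  rcases i with i | i <;> rcases j with j | j
  · simp
  · rw [Subsingleton.elim i 0]; simp [h2']
  · rw [Subsingleton.elim j 0]; simp [h1']
  · simp

theorem odd_card (hq : Even q) : Odd (Fintype.card (Fin 1 ⊕ Fin q)) := by
  simp [hq]

open Classical in
/-- The coset of the half turn about `a`, with junk value at `a = 0`. -/
def halfTurnCoset (hq : Even q) (a : Fin 1 ⊕ Fin q → ℝ) : SOC 1 q ⧸ SOCrealForm 1 q :=
  if ha : a = 0 then ((1 : SOC 1 q) : SOC 1 q ⧸ SOCrealForm 1 q) else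
    (ofRotation (halfTurn a) (by rw [halfTurn_transpose, halfTurn_mul_self ha])
      (det_halfTurn (odd_card hq) ha) : SOC 1 q)

theorem halfTurnCoset_of_ne (hq : Even q) {a : Fin 1 ⊕ Fin q → ℝ} (ha : a ≠ 0) :
    halfTurnCoset hq a = (ofRotation (halfTurn a) (by rw [halfTurn_transpose, halfTurn_mul_self ha])
      (det_halfTurn (odd_card hq) ha) : SOC 1 q) := dif_neg ha

theorem continuousAt_halfTurnCoset (hq : Even q) {a : Fin 1 ⊕ Fin q → ℝ} (ha : a ≠ 0) :
    ContinuousAt (halfTurnCoset hq) a := by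
  let f : {a : Fin 1 ⊕ Fin q → ℝ // a ≠ 0} → SOC 1 q := fun a =>
    ofRotation (halfTurn a) (by rw [halfTurn_transpose, halfTurn_mul_self a.2])
      (det_halfTurn (odd_card hq) a.2)
  have hf : Continuous f := by
    refine (isClosedEmbedding_mat (p := 1) (q := q)).isInducing.continuous_iff.2 ?_
    have h0 : ContinuousOn halfTurn {a : Fin 1 ⊕ Fin q → ℝ | a ≠ 0} :=
      fun a ha => (continuousAt_halfTurn ha).continuousWithinAt
    have h1 := continuousOn_iff_continuous_domRestrict.1 h0
    have h2 : Continuous fun M : Matrix (Fin 1 ⊕ Fin q) (Fin 1 ⊕ Fin q) ℝ =>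
        (sqrtJC 1 q)ᴴ * M.map Complex.ofReal * sqrtJC 1 q :=
      (continuous_const.matrix_mul (continuous_id.matrix_map Complex.continuous_ofReal)).matrix_mul
        continuous_const
    have h3 : mat ∘ f = (fun M : Matrix (Fin 1 ⊕ Fin q) (Fin 1 ⊕ Fin q) ℝ =>
        (sqrtJC 1 q)ᴴ * M.map Complex.ofReal * sqrtJC 1 q) ∘
        Set.domRestrict {a : Fin 1 ⊕ Fin q → ℝ | a ≠ 0} halfTurn := rfl
    rw [h3]
    exact h2.comp h1
  have hopen : IsOpen {a : Fin 1 ⊕ Fin q → ℝ | a ≠ 0} := isOpen_ne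
  have h2 : ContinuousOn (halfTurnCoset hq) {a : Fin 1 ⊕ Fin q → ℝ | a ≠ 0} := by
    rw [continuousOn_iff_continuous_domRestrict]
    have h3 := (QuotientGroup.continuous_mk (N := SOCrealForm 1 q)).comp hf
    refine h3.congr fun a => ?_
    exact (halfTurnCoset_of_ne hq a.2).symm
  exact h2.continuousAt (hopen.mem_nhds ha)

open Classical in
/-- The coset of a rotation taking the first basis vector to `u` or `-u`, for a unit vector `u`. -/
def rotationCoset (hq : Even q) (u : Fin 1 ⊕ Fin q → ℝ) : SOC 1 q ⧸ SOCrealForm 1 q :=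
  if u = -Pi.single (Sum.inl 0) 1 then halfTurnCoset hq (-u + Pi.single (Sum.inl 0) 1)
  else halfTurnCoset hq (u + Pi.single (Sum.inl 0) 1)

theorem single_inl_ne_neg :
    (Pi.single (Sum.inl 0) 1 : Fin 1 ⊕ Fin q → ℝ) ≠ -Pi.single (Sum.inl 0) 1 := by
  intro h
  have := congrFun h (Sum.inl 0)
  simp at this
  norm_num at this

theorem halfTurnCoset_neg_add (hq : Even q) {u : Fin 1 ⊕ Fin q → ℝ} (hu : u ⬝ᵥ u = 1)
    (h1 : u ≠ -Pi.single (Sum.inl 0) 1) (h2 : u ≠ Pi.single (Sum.inl 0) 1) :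
    halfTurnCoset hq (u + Pi.single (Sum.inl 0) 1) =
      halfTurnCoset hq (-u + Pi.single (Sum.inl 0) 1) := by
  have h1' : u + Pi.single (Sum.inl 0) 1 ≠ 0 := fun h => h1 (eq_neg_of_add_eq_zero_left h)
  have h2' : -u + Pi.single (Sum.inl 0) 1 ≠ 0 := fun h => h2 (neg_add_eq_zero.1 h)
  rw [halfTurnCoset_of_ne hq h1', halfTurnCoset_of_ne hq h2']
  refine mk_ofRotation_eq _ _ _ _ (ε := -1) (by norm_num) ?_
  rw [halfTurn_mulVec_of_dotProduct_eq (by simp [hu]) h1',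
    halfTurn_mulVec_of_dotProduct_eq (by simp [hu]) h2', neg_one_smul]

theorem continuousOn_rotationCoset (hq : Even q) :
    ContinuousOn (rotationCoset hq) {u | u ⬝ᵥ u = 1} := by
  intro u hu
  by_cases h : u = -Pi.single (Sum.inl 0) 1
  · have hne : u ≠ Pi.single (Sum.inl 0) 1 := by
      rw [h]; exact single_inl_ne_neg.symm
    have h2' : -u + Pi.single (Sum.inl 0) 1 ≠ 0 := fun h => hne (neg_add_eq_zero.1 h)
    have hc : Continuous fun v : Fin 1 ⊕ Fin q → ℝ => -v + Pi.single (Sum.inl 0) (1 : ℝ) :=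
      continuous_neg.add continuous_const
    have h3 : ContinuousAt (halfTurnCoset hq ∘
        fun v : Fin 1 ⊕ Fin q → ℝ => -v + Pi.single (Sum.inl 0) (1 : ℝ)) u :=
      ContinuousAt.comp (continuousAt_halfTurnCoset hq h2') hc.continuousAt
    refine h3.continuousWithinAt.congr_of_eventuallyEq ?_ (if_pos h)
    filter_upwards [self_mem_nhdsWithin, nhdsWithin_le_nhds (isOpen_ne.mem_nhds hne)] with v hv hv'
    by_cases hv2 : v = -Pi.single (Sum.inl 0) 1
    · exact if_pos hv2
    · rw [rotationCoset, if_neg hv2]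
      exact halfTurnCoset_neg_add hq hv hv2 hv'
  · have h1' : u + Pi.single (Sum.inl 0) 1 ≠ 0 := fun h' => h (eq_neg_of_add_eq_zero_left h')
    have hc : Continuous fun v : Fin 1 ⊕ Fin q → ℝ => v + Pi.single (Sum.inl 0) (1 : ℝ) :=
      continuous_id.add continuous_const
    have h3 : ContinuousAt (halfTurnCoset hq ∘
        fun v : Fin 1 ⊕ Fin q → ℝ => v + Pi.single (Sum.inl 0) (1 : ℝ)) u :=
      ContinuousAt.comp (continuousAt_halfTurnCoset hq h1') hc.continuousAt
    refine (h3.congr ?_).continuousWithinAt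
    filter_upwards [isOpen_ne.mem_nhds h] with v hv
    exact (if_neg hv).symm

theorem exists_rotationCoset_eq (hq : Even q) {u : Fin 1 ⊕ Fin q → ℝ} (hu : u ⬝ᵥ u = 1) :
    ∃ (O : Matrix (Fin 1 ⊕ Fin q) (Fin 1 ⊕ Fin q) ℝ) (hO : Oᵀ * O = 1) (hd : O.det = 1) (ε : ℝ),
      O *ᵥ Pi.single (Sum.inl 0) 1 = ε • u ∧
      rotationCoset hq u = (ofRotation O hO hd : SOC 1 q) := by
  by_cases h : u = -Pi.single (Sum.inl 0) 1
  · have hne : u ≠ Pi.single (Sum.inl 0) 1 := by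
      rw [h]; exact single_inl_ne_neg.symm
    have h2' : -u + Pi.single (Sum.inl 0) 1 ≠ 0 := fun h => hne (neg_add_eq_zero.1 h)
    refine ⟨_, _, _, -1, ?_, (if_pos h).trans (halfTurnCoset_of_ne hq h2')⟩
    rw [halfTurn_mulVec_of_dotProduct_eq (by simp [hu]) h2', neg_one_smul]
  · have h1' : u + Pi.single (Sum.inl 0) 1 ≠ 0 := fun h' => h (eq_neg_of_add_eq_zero_left h')
    refine ⟨_, _, _, 1, ?_, (if_neg h).trans (halfTurnCoset_of_ne hq h1')⟩
    rw [halfTurn_mulVec_of_dotProduct_eq (by simp [hu]) h1', one_smul]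

end SOC

section

open scoped Pointwise

namespace SOC

variable {q : ℕ}

/-- The imaginary part of the Gram matrix of `g` in the coordinates in which the unitary elements
of `SOC p q` are the real rotations. -/
def twist {p : ℕ} (g : SOC p q) : Matrix (Fin p ⊕ Fin q) (Fin p ⊕ Fin q) ℝ :=
  (sqrtJC p q * ((mat g)ᴴ * mat g) * (sqrtJC p q)ᴴ).map Complex.im

theorem twist_transpose {p : ℕ} (g : SOC p q) : (twist g)ᵀ = -twist g := by
  have h : (sqrtJC p q * ((mat g)ᴴ * mat g) * (sqrtJC p q)ᴴ)ᴴ =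
      sqrtJC p q * ((mat g)ᴴ * mat g) * (sqrtJC p q)ᴴ := by
    simp only [conjTranspose_mul, conjTranspose_conjTranspose, mul_assoc]
  ext i j
  have h1 := congrArg Complex.im (congrFun₂ h i j)
  rw [conjTranspose_apply, Complex.star_def, Complex.conj_im] at h1
  exact neg_eq_iff_eq_neg.1 h1

theorem gram_mul_ofRotation_apply (g : SOC 1 q) (O : Matrix (Fin 1 ⊕ Fin q) (Fin 1 ⊕ Fin q) ℝ)
    (hO : Oᵀ * O = 1) (hd : O.det = 1) (j : Fin q) :
    gram (g * ofRotation O hO hd) (Sum.inl 0) (Sum.inr j) =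
      -(Oᵀ * twist g * O) (Sum.inl 0) (Sum.inr j) := by
  have h : (mat (g * ofRotation O hO hd))ᴴ * mat (g * ofRotation O hO hd) =
      (sqrtJC 1 q)ᴴ * (Oᵀ.map Complex.ofReal * (sqrtJC 1 q * ((mat g)ᴴ * mat g) * (sqrtJC 1 q)ᴴ) *
        O.map Complex.ofReal) * sqrtJC 1 q := by
    rw [mat_mul, mat_ofRotation, ← map_ofReal_conjTranspose]
    simp only [conjTranspose_mul, conjTranspose_conjTranspose, mul_assoc]
  rw [gram, h, twist, ← map_im_ofReal_mul, ← map_im_mul_ofReal]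
  generalize Oᵀ.map Complex.ofReal * (sqrtJC 1 q * ((mat g)ᴴ * mat g) * (sqrtJC 1 q)ᴴ) *
    O.map Complex.ofReal = Y
  rw [map_apply, map_apply, sqrtJC, diagonal_conjTranspose, mul_diagonal, diagonal_mul]
  simp

variable (Γ : Subgroup (SOC 1 q)) {χ : SOC 1 q ⧸ SOCrealForm 1 q → ℝ}
  [ProperlyDiscontinuousSMul ↥Γ (SOC 1 q ⧸ SOCrealForm 1 q)]

theorem exists_mem_unitaries_average_eq_zero (hq : Even q) (hχ : HasCompactSupport χ)
    (hχc : Continuous χ) (g : SOC 1 q) :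
    ∃ k ∈ unitaries 1 q, ∀ j, average Γ χ (g * k) (Sum.inl 0) (Sum.inr j) = 0 := by
  obtain ⟨Φ, -, hΦ⟩ := exists_finset_average_eq_sum Γ hχ
    ((isCompact_singleton (x := g)).mul (isCompact_unitaries (p := 1) (q := q)))
  let E := EuclideanSpace ℝ (Fin 1 ⊕ Fin q)
  let Z : E → Matrix (Fin 1 ⊕ Fin q) (Fin 1 ⊕ Fin q) ℝ := fun u =>
    ∑ γ ∈ Φ, χ (((γ : SOC 1 q) * g) • rotationCoset hq u.ofLp) • twist ((γ : SOC 1 q) * g)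
  have hZT : ∀ u, (Z u)ᵀ = -Z u := by
    intro u
    simp only [Z, transpose_sum, transpose_smul, twist_transpose, smul_neg, Finset.sum_neg_distrib]
  have hsphere : ∀ u : E, u ∈ Metric.sphere (0 : E) 1 → u.ofLp ⬝ᵥ u.ofLp = 1 := by
    intro u hu
    have h1 : ‖u‖ = 1 := by simpa using hu
    have h2 := EuclideanSpace.real_norm_sq_eq u
    rw [h1] at h2
    simp only [dotProduct, ← pow_two]
    rw [← h2]; norm_num
  have hZc : ContinuousOn Z (Metric.sphere (0 : E) 1) := by
    refine continuousOn_finsetSum _ fun γ _ => ?_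
    have h : ContinuousOn (fun u : E => χ (((γ : SOC 1 q) * g) • rotationCoset hq u.ofLp))
        (Metric.sphere (0 : E) 1) := by
      refine hχc.comp_continuousOn ?_
      refine (continuous_const_smul ((γ : SOC 1 q) * g)).comp_continuousOn ?_
      exact (continuousOn_rotationCoset hq).comp (PiLp.continuous_ofLp 2 _).continuousOn hsphere
    exact h.smul continuousOn_const
  have hw : ContinuousOn (fun u : E => (WithLp.toLp 2 (Z u *ᵥ u.ofLp) : E))
      (Metric.sphere (0 : E) 1) := by
    refine (PiLp.continuous_toLp 2 _).comp_continuousOn ?_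
    rw [continuousOn_iff_continuous_domRestrict] at hZc ⊢
    exact Continuous.matrix_mulVec hZc
      ((PiLp.continuous_ofLp 2 _).comp continuous_subtype_val)
  obtain ⟨u, hu, hu0⟩ := exists_eq_zero_of_tangent_sphere (E := E)
    (by rw [finrank_euclideanSpace]; exact odd_card hq) hw (fun u _ => by
      rw [EuclideanSpace.inner_eq_star_dotProduct]
      have h1 : u.ofLp ⬝ᵥ (Z u *ᵥ u.ofLp) = -(u.ofLp ⬝ᵥ (Z u *ᵥ u.ofLp)) := by
        conv_lhs => rw [dotProduct_mulVec, ← mulVec_transpose, hZT, neg_mulVec, neg_dotProduct,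
          dotProduct_comm]
      have h2 : u.ofLp ⬝ᵥ (Z u *ᵥ u.ofLp) = 0 := by linarith
      simpa using h2)
  obtain ⟨O, hO, hd, ε, hOu, hcoset⟩ := exists_rotationCoset_eq hq (hsphere u hu)
  refine ⟨ofRotation O hO hd, ofRotation_mem_unitaries O hO hd, fun j => ?_⟩
  have hZu : Z u *ᵥ u.ofLp = 0 := congrArg WithLp.ofLp hu0
  have h1 : average Γ χ (g * ofRotation O hO hd) (Sum.inl 0) (Sum.inr j) =
      -(Oᵀ * Z u * O) (Sum.inl 0) (Sum.inr j) := by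
    rw [hΦ _ (Set.mul_mem_mul rfl (ofRotation_mem_unitaries O hO hd)), Matrix.sum_apply]
    simp only [Z, Finset.mul_sum, Finset.sum_mul]
    rw [Matrix.sum_apply, ← Finset.sum_neg_distrib]
    refine Finset.sum_congr rfl fun γ _ => ?_
    rw [Matrix.smul_apply, ← mul_assoc, gram_mul_ofRotation_apply, hcoset, mul_smul_comm,
      smul_mul_assoc, Matrix.smul_apply, smul_neg]
    rfl
  have h2 : (Oᵀ * Z u * O)ᵀ = -(Oᵀ * Z u * O) := by
    simp [transpose_mul, hZT, mul_assoc]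
  have h3 : (Oᵀ * Z u * O) *ᵥ Pi.single (Sum.inl 0) 1 = 0 := by
    rw [← mulVec_mulVec, hOu, mulVec_smul, ← mulVec_mulVec, hZu, mulVec_zero, smul_zero]
  have h4 : (Oᵀ * Z u * O) (Sum.inr j) (Sum.inl 0) = 0 := by
    have := congrFun h3 (Sum.inr j)
    simpa [mulVec_single] using this
  rw [h1, ← h4]
  exact (congrFun₂ h2 (Sum.inl 0) (Sum.inr j)).symm

end SOC

end

section

open scoped Pointwise

/-- An eigenvector of a pencil `A - μ J` normalized by `f ⬝ᵥ J f = 1` is bounded in terms of the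
bounds on `A`. -/
theorem dotProduct_self_le_of_mulVec_eq_smul {ι : Type*} [Fintype ι] [DecidableEq ι]
    {A J : Matrix ι ι ℝ} (hJ : J * J = 1) (hJT : Jᵀ = J) {f : ι → ℝ} {μ α β : ℝ}
    (h : A *ᵥ f = μ • (J *ᵥ f)) (hf : f ⬝ᵥ (J *ᵥ f) = 1) (hα : 0 < α) (hβ : ∀ i j, |A i j| ≤ β)
    (hA : α * (f ⬝ᵥ f) ≤ f ⬝ᵥ (A *ᵥ f)) (hJ1 : ∀ i, |(J *ᵥ f) i| ≤ |f i|) :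
    f ⬝ᵥ f ≤ Fintype.card ι * β / α := by
  have hff : 0 < f ⬝ᵥ f := by
    refine lt_of_le_of_ne (Finset.sum_nonneg fun i _ => mul_self_nonneg _) fun h0 => ?_
    rw [dotProduct_self_eq_zero.1 h0.symm] at hf
    simp at hf
  have hμ : f ⬝ᵥ (A *ᵥ f) = μ := by rw [h, dotProduct_smul, hf, smul_eq_mul, mul_one]
  have hJJ : (J *ᵥ f) ⬝ᵥ (J *ᵥ f) = f ⬝ᵥ f := by
    rw [dotProduct_mulVec, ← mulVec_transpose, hJT, mulVec_mulVec, hJ, one_mulVec]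
  have h1 : (J *ᵥ f) ⬝ᵥ (A *ᵥ f) = μ * (f ⬝ᵥ f) := by
    rw [h, dotProduct_smul, hJJ, smul_eq_mul]
  have h2 : (J *ᵥ f) ⬝ᵥ (A *ᵥ f) ≤ Fintype.card ι * β * (f ⬝ᵥ f) := by
    calc (J *ᵥ f) ⬝ᵥ (A *ᵥ f) ≤ ∑ i, ∑ j, β * ((f i ^ 2 + f j ^ 2) / 2) := by
          refine Finset.sum_le_sum fun i _ => ?_
          rw [show (A *ᵥ f) i = ∑ j, A i j * f j from rfl, Finset.mul_sum]
          refine Finset.sum_le_sum fun j _ => ?_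
          have hb0 : 0 ≤ β := (abs_nonneg _).trans (hβ i j)
          calc (J *ᵥ f) i * (A i j * f j) ≤ |(J *ᵥ f) i * (A i j * f j)| := le_abs_self _
            _ = |A i j| * (|(J *ᵥ f) i| * |f j|) := by rw [abs_mul, abs_mul]; ring
            _ ≤ β * (|f i| * |f j|) := mul_le_mul (hβ i j)
                (mul_le_mul_of_nonneg_right (hJ1 i) (abs_nonneg _)) (by positivity) hb0
            _ ≤ β * ((f i ^ 2 + f j ^ 2) / 2) := by
                gcongr
                have := two_mul_le_add_sq (|f i|) (|f j|)
                rw [sq_abs, sq_abs] at this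
                linarith
      _ = Fintype.card ι * β * (f ⬝ᵥ f) := by
          simp only [← Finset.mul_sum, ← Finset.sum_div, Finset.sum_add_distrib, Finset.sum_const,
            Finset.card_univ, nsmul_eq_mul, dotProduct, ← pow_two]
          ring
  have h3 : μ ≤ Fintype.card ι * β := by
    rw [h1] at h2
    exact le_of_mul_le_mul_right h2 hff
  rw [le_div_iff₀ hα, mul_comm]
  exact hA.trans (hμ.le.trans h3)

namespace SOC

/-- The real matrix underlying `JC p q`. -/
def realJ (p q : ℕ) : Matrix (Fin p ⊕ Fin q) (Fin p ⊕ Fin q) ℝ :=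
  Matrix.diagonal (Sum.elim (fun _ => 1) (fun _ => -1))

theorem realJ_map (p q : ℕ) : (realJ p q).map Complex.ofReal = JC p q := by
  rw [realJ, JC, diagonal_map (by simp)]
  congr 1
  ext i
  rcases i with i | i <;> simp

theorem realJ_mul_self (p q : ℕ) : realJ p q * realJ p q = 1 := by
  rw [realJ, diagonal_mul_diagonal, ← diagonal_one]
  congr 1
  ext i
  rcases i with i | i <;> simp

theorem realJ_transpose (p q : ℕ) : (realJ p q)ᵀ = realJ p q := diagonal_transpose _

theorem map_ofReal_injective {ι : Type*} :
    Function.Injective fun M : Matrix ι ι ℝ => M.map Complex.ofReal := fun A B h => by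
  ext i j
  exact Complex.ofReal_injective (congrFun₂ h i j)

variable {p q : ℕ}

theorem map_re_transpose_mul {η : SOC p q} (hη : η ∈ SOCrealForm p q) :
    ((mat η).map Complex.re)ᵀ * realJ p q * (mat η).map Complex.re = realJ p q := by
  apply map_ofReal_injective
  have hT : (((mat η).map Complex.re)ᵀ).map Complex.ofReal = (mat η)ᵀ :=
    congrArg transpose (map_re_map_ofReal_of_mem hη)
  simp only [map_ofReal_mul]
  rw [realJ_map, hT, map_re_map_ofReal_of_mem hη, mat_transpose_mul]

theorem map_re_mul_transpose {η : SOC p q} (hη : η ∈ SOCrealForm p q) :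
    (mat η).map Complex.re * realJ p q * ((mat η).map Complex.re)ᵀ = realJ p q := by
  apply map_ofReal_injective
  have hT : (((mat η).map Complex.re)ᵀ).map Complex.ofReal = (mat η)ᵀ :=
    congrArg transpose (map_re_map_ofReal_of_mem hη)
  simp only [map_ofReal_mul]
  rw [realJ_map, hT, map_re_map_ofReal_of_mem hη, mat_mul_transpose]

/-- A Lorentz transformation is bounded in terms of its first column. -/
theorem sq_apply_le_of_transpose_mul {B : Matrix (Fin 1 ⊕ Fin q) (Fin 1 ⊕ Fin q) ℝ}
    (h1 : Bᵀ * realJ 1 q * B = realJ 1 q) (h2 : B * realJ 1 q * Bᵀ = realJ 1 q) {R : ℝ}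
    (hR : ∑ i, B i (Sum.inl 0) ^ 2 ≤ R) (i j : Fin 1 ⊕ Fin q) : B i j ^ 2 ≤ 1 + R := by
  have e1 : ∀ j, B (Sum.inl 0) (Sum.inr j) ^ 2 - ∑ i, B (Sum.inr i) (Sum.inr j) ^ 2 = -1 := by
    intro j
    have := congrFun₂ h1 (Sum.inr j) (Sum.inr j)
    simp only [realJ, mul_apply (M := Bᵀ * _), mul_diagonal, Fintype.sum_sum_type] at this
    simp [← pow_two] at this
    linarith
  have e2 : B (Sum.inl 0) (Sum.inl 0) ^ 2 - ∑ j, B (Sum.inl 0) (Sum.inr j) ^ 2 = 1 := by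
    have := congrFun₂ h2 (Sum.inl 0) (Sum.inl 0)
    simp only [realJ, mul_apply (M := B * _), mul_diagonal, Fintype.sum_sum_type] at this
    simp [← pow_two] at this
    linarith
  have e3 : ∀ i, B i (Sum.inl 0) ^ 2 ≤ R := fun i =>
    (Finset.single_le_sum (f := fun i => B i (Sum.inl 0) ^ 2) (fun _ _ => sq_nonneg _)
      (Finset.mem_univ i)).trans hR
  have e4 : ∀ j, B (Sum.inl 0) (Sum.inr j) ^ 2 ≤ R - 1 := by
    intro j
    have h : B (Sum.inl 0) (Sum.inr j) ^ 2 ≤ ∑ j, B (Sum.inl 0) (Sum.inr j) ^ 2 :=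
      Finset.single_le_sum (f := fun j => B (Sum.inl 0) (Sum.inr j) ^ 2)
        (fun _ _ => sq_nonneg _) (Finset.mem_univ j)
    linarith [e3 (Sum.inl 0)]
  rcases j with j | j
  · rw [Subsingleton.elim j 0]
    linarith [e3 i]
  · rcases i with i | i
    · rw [Subsingleton.elim i 0]
      linarith [e4 j]
    · have h : B (Sum.inr i) (Sum.inr j) ^ 2 ≤ ∑ i, B (Sum.inr i) (Sum.inr j) ^ 2 :=
        Finset.single_le_sum (f := fun i => B (Sum.inr i) (Sum.inr j) ^ 2)
          (fun _ _ => sq_nonneg _) (Finset.mem_univ i)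
      linarith [e1 j, e4 j]

theorem exists_isCompact_of_average_eq_zero (Γ : Subgroup (SOC 1 q))
    {χ : SOC 1 q ⧸ SOCrealForm 1 q → ℝ}
    [ProperlyDiscontinuousSMul ↥Γ (SOC 1 q ⧸ SOCrealForm 1 q)]
    (hχ : HasCompactSupport χ) (hχc : Continuous χ) (hχ0 : ∀ x, 0 ≤ χ x)
    {C : Set (SOC 1 q)} (hC : IsCompact C) (hχC : ∀ c ∈ C, χ (c : SOC 1 q) = 1) :
    ∃ C' : Set (SOC 1 q), IsCompact C' ∧ ∀ c ∈ C, ∀ η ∈ SOCrealForm 1 q,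
      (∀ j, average Γ χ (c * η) (Sum.inl 0) (Sum.inr j) = 0) → c * η ∈ C' := by
  obtain ⟨α, β, hα, hβ, hαβ⟩ := exists_average_bounds Γ hχ hχc hχ0 hC hχC
  set R : ℝ := ((Fintype.card (Fin 1 ⊕ Fin q) : ℕ) : ℝ) * β / α with hR
  have hR0 : 0 ≤ R := by positivity
  let S : Set (SOC 1 q) := {η | ∀ i j, ‖mat η i j‖ ≤ 1 + R}
  have hS : IsCompact S := by
    refine isCompact_of_bounded ?_ fun η hη => hη
    simp only [S, Set.ofPred_forall]
    exact isClosed_iInter fun i => isClosed_iInter fun j =>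
      isClosed_le (continuous_mat_apply i j).norm continuous_const
  refine ⟨C * S, hC.mul hS, fun c hc η hη h => Set.mul_mem_mul hc ?_⟩
  set B := (mat η).map Complex.re with hB
  set A := average Γ χ c with hA
  set e : Fin 1 ⊕ Fin q → ℝ := Pi.single (Sum.inl 0) 1 with he
  have hBA : average Γ χ (c * η) = Bᵀ * A * B := average_mul_of_mem Γ hχ hη c
  have hB1 := map_re_transpose_mul hη
  have hB2 := map_re_mul_transpose hη
  rw [← hB] at hB1 hB2
  have hAT : Aᵀ = A := by
    have hg : ∀ g : SOC 1 q, (gram g)ᵀ = gram g := by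
      intro g
      have h1 : ((mat g)ᴴ * mat g)ᴴ = (mat g)ᴴ * mat g := by simp
      ext i j
      have h2 := congrArg Complex.re (congrFun₂ h1 i j)
      rw [conjTranspose_apply, Complex.star_def, Complex.conj_re] at h2
      exact h2
    obtain ⟨Φ, -, hΦ⟩ := exists_finset_average_eq_sum Γ hχ hC
    rw [hA, hΦ c hc, transpose_sum]
    simp only [transpose_smul, hg]
  set μ := (Bᵀ * A * B) (Sum.inl 0) (Sum.inl 0) with hμ
  have hBe : (Bᵀ * A * B) *ᵥ e = μ • e := by
    have hT : (Bᵀ * A * B)ᵀ = Bᵀ * A * B := by simp [transpose_mul, hAT, mul_assoc]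
    ext i
    have h0 : ∀ i, (Bᵀ * A * B) (Sum.inr i) (Sum.inl 0) = 0 := fun i => by
      rw [← hT, transpose_apply, ← hBA]
      exact h i
    generalize Bᵀ * A * B = M at hμ h0 ⊢
    rw [he, mulVec_single]
    rcases i with i | i
    · rw [Subsingleton.elim i 0]
      simp [hμ]
    · simp [h0]
  have hJe : realJ 1 q *ᵥ e = e := by
    ext i
    rw [realJ, mulVec_diagonal]
    rcases i with i | i <;> simp [he]
  have hBinv : realJ 1 q * B * realJ 1 q * Bᵀ = 1 := by
    rw [mul_assoc, mul_assoc, ← mul_assoc B, hB2, realJ_mul_self]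
  have hf : A *ᵥ (B *ᵥ e) = μ • (realJ 1 q *ᵥ (B *ᵥ e)) := by
    have h1 : (realJ 1 q * B * realJ 1 q) *ᵥ ((Bᵀ * A * B) *ᵥ e) = A *ᵥ (B *ᵥ e) := by
      rw [mulVec_mulVec, mulVec_mulVec, ← mul_assoc, ← mul_assoc, hBinv, one_mul]
    rw [← h1, hBe, mulVec_smul, ← mulVec_mulVec, hJe, mulVec_mulVec]
  have hfJ : (B *ᵥ e) ⬝ᵥ (realJ 1 q *ᵥ (B *ᵥ e)) = 1 := by
    have h1 : (B *ᵥ e) ⬝ᵥ (realJ 1 q *ᵥ (B *ᵥ e)) = e ⬝ᵥ ((Bᵀ * realJ 1 q * B) *ᵥ e) := by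
      rw [dotProduct_comm, dotProduct_mulVec, ← mulVec_transpose, dotProduct_comm, mulVec_mulVec,
        mulVec_mulVec, mul_assoc]
    rw [h1, hB1, hJe]
    simp [he]
  have hbound := dotProduct_self_le_of_mulVec_eq_smul (realJ_mul_self 1 q) (realJ_transpose 1 q)
    hf hfJ hα (hαβ c hc).1 ((hαβ c hc).2 _) (fun i => by
      rw [realJ, mulVec_diagonal]
      rcases i with i | i <;> simp)
  have hcol : ∑ i, B i (Sum.inl 0) ^ 2 ≤ R := by
    refine le_trans (le_of_eq ?_) hbound
    simp [dotProduct, he, mulVec_single, pow_two]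
  intro i j
  have h3 := sq_apply_le_of_transpose_mul hB1 hB2 hcol i j
  have h4 : mat η i j = (B i j : ℂ) := (congrFun₂ (map_re_map_ofReal_of_mem hη) i j).symm
  rw [h4, Complex.norm_real, Real.norm_eq_abs]
  refine abs_le_of_sq_le_sq (h3.trans ?_) (by positivity)
  nlinarith

theorem not_cocompact_of_even (hq0 : 0 < q) (hq : Even q) (Γ : Subgroup (SOC 1 q))
    [ProperlyDiscontinuousSMul ↥Γ (SOC 1 q ⧸ SOCrealForm 1 q)] :
    ¬ CompactSpace (MulAction.orbitRel.Quotient ↥Γ (SOC 1 q ⧸ SOCrealForm 1 q)) := by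
  intro hcpt
  obtain ⟨C, hC, hCG⟩ := exists_isCompact_forall_eq_mul_mul Γ (SOCrealForm 1 q)
  have : IsClosed (SOCrealForm 1 q : Set (SOC 1 q)) := isClosed_realForm
  obtain ⟨χ, hχ1, -, hχs, hχ01⟩ := exists_continuous_one_zero_of_isCompact
    (hC.image (QuotientGroup.continuous_mk (N := SOCrealForm 1 q))) isClosed_empty
    (Set.disjoint_empty _)
  have hχC : ∀ c ∈ C, χ (c : SOC 1 q) = 1 := fun c hc => hχ1 ⟨c, hc, rfl⟩
  obtain ⟨C', hC', hCC'⟩ := exists_isCompact_of_average_eq_zero Γ hχs χ.continuous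
    (fun x => (hχ01 x).1) hC hχC
  have hcover : ∀ g : SOC 1 q, ∃ γ ∈ Γ, ∃ b ∈ C' * (unitaries 1 q : Set (SOC 1 q)), g = γ * b := by
    intro g
    obtain ⟨k, hk, hk0⟩ := exists_mem_unitaries_average_eq_zero Γ hq hχs χ.continuous g
    obtain ⟨γ, hγ, c, hc, η, hη, h⟩ := hCG (g * k)
    refine ⟨γ, hγ, c * η * k⁻¹, Set.mul_mem_mul (hCC' c hc η hη fun j => ?_)
      ((unitaries 1 q).inv_mem hk), ?_⟩
    · rw [← average_mul_left Γ χ hγ, ← mul_assoc, ← h]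
      exact hk0 j
    · rw [← mul_assoc, ← mul_assoc, ← h, mul_inv_cancel_right]
  have hb := hC'.mul (isCompact_unitaries (p := 1) (q := q))
  have hfin := ProperlyDiscontinuousSMul.finite_setOf_mul_eq_mul Γ (SOCrealForm 1 q) hb
    (isCompact_singleton (x := 1))
  obtain ⟨R, hR0, hR⟩ := exists_bound_of_isCompact (hfin.isCompact.mul hb)
  obtain ⟨t, ht⟩ := exists_lt_cosh R
  set a : Fin 1 ⊕ Fin q := Sum.inl 0
  set b : Fin 1 ⊕ Fin q := Sum.inr ⟨0, hq0⟩
  have hab : a ≠ b := by simp [a, b]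
  set N : Matrix (Fin 1 ⊕ Fin q) (Fin 1 ⊕ Fin q) ℂ := single a b 1 + single b a 1 with hNdef
  have hNN : N * N = single a a 1 + single b b 1 := by
    rw [hNdef, add_mul, mul_add, mul_add, single_mul_single_same, single_mul_single_same,
      single_mul_single_of_ne _ _ _ _ hab.symm, single_mul_single_of_ne _ _ _ _ hab]
    simp
  have hN : N * N * N = N := by
    rw [hNN, hNdef, add_mul, mul_add, mul_add, single_mul_single_same, single_mul_single_same,
      single_mul_single_of_ne _ _ _ _ hab.symm, single_mul_single_of_ne _ _ _ _ hab]
    simp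
  have hNJ : Nᵀ * JC 1 q = -(JC 1 q * N) := by
    ext i j
    rw [Matrix.neg_apply, JC, diagonal_mul, mul_diagonal]
    simp only [hNdef, transpose_apply, Matrix.add_apply, single_apply]
    rcases i with i | i <;> rcases j with j | j <;> simp [a, b, and_comm]
    split_ifs <;> simp
  have hreal : boost hN hNJ t ∈ SOCrealForm 1 q := by
    rw [mem_realForm_iff]
    intro i j
    rw [mat_boost, boostMatrix, hNN, hNdef]
    simp only [Matrix.add_apply, Matrix.smul_apply, single_apply, one_apply]
    split_ifs <;> simp
  obtain ⟨γ, hγ, x, hx, h⟩ := hcover (boost hN hNJ t)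
  have h1 := hR _ (Set.mul_mem_mul (s := {γ : SOC 1 q | _}) ⟨hγ, x, hx, 1, rfl, _, hreal,
    by rw [one_mul, h]⟩ hx) a a
  have h2 : boostMatrix N t a a = (Real.cosh t : ℂ) := by
    rw [boostMatrix, hNN]
    simp [hNdef, hab.symm]
  rw [← h, mat_boost, h2, Complex.norm_real] at h1
  exact absurd ((le_abs_self _).trans h1) (not_le.2 ht)

end SOC

end

/-- **No compact Clifford–Klein forms for `SO(p+q,ℂ)/SO(p,q)`.**
If `p > 1` and `q > 1`, or `p = 1` and `q` is even, there is no discrete subgroup `Γ`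
of `G = SO(p+q,ℂ)` acting properly discontinuously and cocompactly on the homogeneous
space `G/H`, where `H` is the real form `SO(p,q)`. -/
theorem no_compact_CliffordKlein_form_SOC_SOpq (p q : ℕ) (hp : 0 < p) (hq : 0 < q)
    (hcase : (1 < p ∧ 1 < q) ∨ (p = 1 ∧ Even q)) :
    ¬ ∃ Γ : Subgroup ↥(SOC p q), DiscreteTopology ↥Γ ∧
      ProperlyDiscontinuousSMul ↥Γ (↥(SOC p q) ⧸ SOCrealForm p q) ∧
      CompactSpace (MulAction.orbitRel.Quotient ↥Γ (↥(SOC p q) ⧸ SOCrealForm p q)) := by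
  rintro ⟨Γ, -, hΓ, hc⟩
  rcases hcase with ⟨h1, h2⟩ | ⟨rfl, he⟩
  · exact SOC.not_cocompact_of_one_lt h1 h2 Γ hc
  · exact SOC.not_cocompact_of_even hq he Γ hc
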